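/- Let A = kQ/I be a simply connected toupie algebra with m = dim_k e_0 A e_∞ ≥ 3 and t branches. If t > m + 1, then A is not a laura algebra. -/

import Mathlib

/-!
Formalization preamble for "Toupie algebras".

We realize the bound quiver algebra `A = kQ/I` of a toupie quiver `Q` concretely:
the path algebra `kQ` is realized, via its (faithful) left regular representation,
as the subalgebra of `Module.End k (paths → k)` generated by the operators of left
multiplication by the trivial paths `e_v` and by the arrows of `Q`.  Paths are
composed from left to right (`p * q` = "first `p`, then `q`"), as in
Assem–Simson–Skowroński, so that paths from the source `0` to the sink `∞` span
`e₀ (kQ) e∞`, and (right) `A`-modules are identified with representations of `(Q, I)`.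
Right `A`-modules are formalized as (left) modules over `Aᵐᵒᵖ`.
-/

set_option synthInstance.maxHeartbeats 400000
set_option maxHeartbeats 800000

noncomputable section
open scoped Classical
open MulOpposite

universe u

namespace Toupie

/-- Vertices of a toupie quiver with `t` branches, branch `i` having length `ℓ i ≥ 1`:
the unique source `src`, the unique sink `snk`, and for each branch `i` its interior
vertices `mid i a` (the `(a+1)`-st vertex on branch `i`, for `a : Fin (ℓ i - 1)`). -/
inductive Vtx (t : ℕ) (ℓ : Fin t → ℕ) : Type
  | src : Vtx t ℓ
  | snk : Vtx t ℓ
  | mid (i : Fin t) (a : Fin (ℓ i - 1)) : Vtx t ℓ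

/-- The `a`-th vertex on branch `i`, for `0 ≤ a ≤ ℓ i`
(`a = 0` is the source, `a = ℓ i` is the sink). -/
def vtx (t : ℕ) (ℓ : Fin t → ℕ) (i : Fin t) (a : ℕ) : Vtx t ℓ :=
  if a = 0 then .src else if h : a - 1 < ℓ i - 1 then .mid i ⟨a - 1, h⟩ else .snk

/-- The paths of a toupie quiver: trivial paths at the vertices, and for each branch
`i` and `a < b ≤ ℓ i` the path `sub i a b` along branch `i` from its `a`-th vertex to
its `b`-th vertex.  (`sub i 0 (ℓ i)` is the `i`-th branch `w i`.) -/
inductive PIdx (t : ℕ) (ℓ : Fin t → ℕ) : Type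
  | vert (v : Vtx t ℓ) : PIdx t ℓ
  | sub (i : Fin t) (a b : ℕ) (hab : a < b) (hb : b ≤ ℓ i) : PIdx t ℓ

variable (k : Type u) [Field k] (t : ℕ) (ℓ : Fin t → ℕ)

/-- The vector space with basis the set of paths of the toupie quiver. -/
abbrev PSp : Type u := PIdx t ℓ → k

variable {t ℓ}

/-- The starting vertex of a path. -/
def startIdx : PIdx t ℓ → Vtx t ℓ
  | .vert v => v
  | .sub i a _ _ _ => vtx t ℓ i a

/-- Left multiplication by the trivial path (primitive idempotent) `e_v`. -/
def Ev (v : Vtx t ℓ) : Module.End k (PSp k t ℓ) where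
  toFun f := fun p => if startIdx p = v then f p else 0
  map_add' f g := by funext p; by_cases h : startIdx p = v <;> simp [h]
  map_smul' c f := by funext p; by_cases h : startIdx p = v <;> simp [h]

/-- Strip the `j`-th arrow of branch `i` (the arrow `vtx i j ⟶ vtx i (j+1)`) from the
front of a path, if possible. -/
def strip (i : Fin t) (j : ℕ) : PIdx t ℓ → Option (PIdx t ℓ)
  | .vert _ => none
  | .sub i' a b _ hb =>
      if h : i' = i ∧ a = j then
        if hb2 : j + 1 < b then some (.sub i (j + 1) b hb2 (h.1 ▸ hb))
        else some (.vert (vtx t ℓ i b))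
      else none

/-- Left multiplication by the `j`-th arrow of branch `i`
(the arrow from `vtx i j` to `vtx i (j+1)`, for `j < ℓ i`; the zero operator for junk `j`). -/
def Ar (i : Fin t) (j : ℕ) : Module.End k (PSp k t ℓ) where
  toFun f := fun p => (strip i j p).elim 0 f
  map_add' f g := by funext p; rcases h : strip i j p with _ | q <;> simp [h]
  map_smul' c f := by funext p; rcases h : strip i j p with _ | q <;> simp [h]

variable (t ℓ)

/-- The generators of the path algebra: the trivial paths and the arrows. -/
def gens : Set (Module.End k (PSp k t ℓ)) :=
  Set.range (Ev k) ∪ {x | ∃ i j, x = Ar k i j}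

/-- The path algebra `kQ` of the toupie quiver, realized as the subalgebra of
`Module.End k (PSp k t ℓ)` generated by left multiplication by trivial paths and arrows. -/
def PathAlg : Subalgebra k (Module.End k (PSp k t ℓ)) :=
  Algebra.adjoin k (gens k t ℓ)

variable {k t ℓ}

/-- The trivial path `e_v` as an element of the path algebra. -/
def eV (v : Vtx t ℓ) : PathAlg k t ℓ :=
  ⟨Ev k v, Algebra.subset_adjoin (Or.inl ⟨v, rfl⟩)⟩

/-- The `j`-th arrow of branch `i` as an element of the path algebra. -/
def arE (i : Fin t) (j : ℕ) : PathAlg k t ℓ :=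
  ⟨Ar k i j, Algebra.subset_adjoin (Or.inr ⟨i, j, rfl⟩)⟩

/-- The path along branch `i` from its `a`-th vertex to its `b`-th vertex, as an element
of the path algebra: the product (composed from left to right) of the arrows
`a → a+1 → ⋯ → b`.  (For `b ≤ a` this is the empty product `1`.) -/
def subE (i : Fin t) (a b : ℕ) : PathAlg k t ℓ :=
  (((List.range (b - a)).map fun s => arE i (a + s)).prod)

/-- The `i`-th branch `w i` (the path from the source to the sink along branch `i`)
as an element of the path algebra. -/
def wE (i : Fin t) : PathAlg k t ℓ := subE i 0 (ℓ i)

variable {k : Type u} [Field k]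

/-- A toupie algebra `A = kQ/I`: a toupie quiver `Q` (a non-linear quiver with a unique
source, a unique sink, and all other vertices having exactly one incoming and one
outgoing arrow, i.e. `t ≥ 2` branches of lengths `ℓ i ≥ 1`), together with an admissible
ideal `I` of the path algebra `kQ`.  Since `Q` is finite and acyclic, the arrow ideal is
nilpotent, so admissibility amounts to `I ⊆ R_Q²`, i.e. every element of `I` is a linear
combination of paths of length `≥ 2`. -/
structure ToupieAlg (k : Type u) [Field k] : Type u where
  t : ℕ
  ht : 2 ≤ t
  ℓ : Fin t → ℕ
  hℓ : ∀ i, 1 ≤ ℓ i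
  I : TwoSidedIdeal (PathAlg k t ℓ)
  adm : ∀ x ∈ I, x ∈ Submodule.span k
    {y : PathAlg k t ℓ | ∃ i a b, a + 2 ≤ b ∧ b ≤ ℓ i ∧ y = subE i a b}

variable (T : ToupieAlg k)

/-- The underlying algebra `A = kQ/I` of a toupie algebra. -/
def Alg : Type u := T.I.ringCon.Quotient

instance : Ring (Alg T) := inferInstanceAs (Ring T.I.ringCon.Quotient)

/-- The quotient map `kQ → A = kQ/I`. -/
def mkA : PathAlg k T.t T.ℓ →+* Alg T := T.I.ringCon.mk'

lemma mkA_surjective : Function.Surjective (mkA T) := Quotient.mk''_surjective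

instance : Algebra k (Alg T) :=
  RingHom.toAlgebra' ((mkA T).comp (algebraMap k (PathAlg k T.t T.ℓ)))
    (by
      intro c x
      obtain ⟨y, rfl⟩ := mkA_surjective T x
      simp only [RingHom.coe_comp, Function.comp_apply, ← map_mul]
      rw [Algebra.commutes])

/-- The idempotent `e₀` (at the source) in `A`. -/
def e0 : Alg T := mkA T (eV Vtx.src)

/-- The idempotent `e∞` (at the sink) in `A`. -/
def einf : Alg T := mkA T (eV Vtx.snk)

/-- The `k`-linear map `A → A`, `x ↦ e₀ * x * e∞`, whose range is `e₀ A e∞`. -/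
def lrMap : Alg T →ₗ[k] Alg T where
  toFun x := e0 T * x * einf T
  map_add' x y := by simp [mul_add, add_mul]
  map_smul' c x := by
    simp only [RingHom.id_apply]
    rw [mul_smul_comm, smul_mul_assoc]

/-- `m = dim_k e₀ A e∞`, the dimension of the span of the (residues of the) paths from
the source to the sink. -/
def mDim : ℕ := Module.finrank k ↥(LinearMap.range (lrMap T))

/-- The branch `w i` lies in the ideal `I`. -/
def branchInI (i : Fin T.t) : Prop := wE i ∈ T.I

/-- A minimal relation: `∑_{i ∈ J} λ i • w i ∈ I` with `|J| ≥ 2`, all `λ i ≠ 0`, and no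
nonempty proper subsum in `I`. -/
def MinRel (J : Finset (Fin T.t)) (lam : Fin T.t → k) : Prop :=
  2 ≤ J.card ∧ (∀ i ∈ J, lam i ≠ 0) ∧ (∑ i ∈ J, lam i • wE i) ∈ T.I ∧
    ∀ J' ⊂ J, J'.Nonempty → (∑ i ∈ J', lam i • wE i) ∉ T.I

/-- A toupie algebra is simply connected if any two distinct branches are involved in a
common minimal relation. -/
def SimplyConnected : Prop :=
  ∀ i j : Fin T.t, i ≠ j → ∃ J lam, MinRel T J lam ∧ i ∈ J ∧ j ∈ J

/-- A (minimal) zero-relation on branch `i`: the subpath of branch `i` from its `a`-th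
to its `b`-th vertex lies in `I`, but no proper subpath of it does. -/
def ZeroRel (i : Fin T.t) (a b : ℕ) : Prop :=
  a < b ∧ b ≤ T.ℓ i ∧ subE i a b ∈ T.I ∧
    ∀ a' b', a ≤ a' → b' ≤ b → a' < b' → (a', b') ≠ (a, b) → subE i a' b' ∉ T.I

/-- There is exactly one relation on branch `i`. -/
def ExactlyOneRel (i : Fin T.t) : Prop := ∃! p : ℕ × ℕ, ZeroRel T i p.1 p.2

/-- Branch `i` carries more than one relation. -/
def MoreThanOneRel (i : Fin T.t) : Prop :=
  ∃ p q : ℕ × ℕ, p ≠ q ∧ ZeroRel T i p.1 p.2 ∧ ZeroRel T i q.1 q.2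

/-- At most one branch of `Q` has length at least three. -/
def AtMostOneLongBranch : Prop := ∀ i j : Fin T.t, 3 ≤ T.ℓ i → 3 ≤ T.ℓ j → i = j

/-- The two-sided ideal `I` is generated by the set `S`. -/
def IsGenBy {R : Type u} [Ring R] (I : TwoSidedIdeal R) (S : Set R) : Prop :=
  S ⊆ (I : Set R) ∧ ∀ J : TwoSidedIdeal R, S ⊆ (J : Set R) → (I : Set R) ⊆ (J : Set R)

/-- A toupie algebra is canonical if (after choosing two distinguished branches `i₁, i₂`)
its ideal is generated by `{w i₁ + λ j • w i₂ - w j}` over the remaining branches `j`,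
with the `λ j` pairwise distinct and nonzero. -/
def IsCanonical : Prop :=
  ∃ (i₁ i₂ : Fin T.t) (lam : Fin T.t → k), i₁ ≠ i₂ ∧
    (∀ j, j ≠ i₁ → j ≠ i₂ → lam j ≠ 0) ∧
    (∀ j j', j ≠ i₁ → j ≠ i₂ → j' ≠ i₁ → j' ≠ i₂ → j ≠ j' → lam j ≠ lam j') ∧
    IsGenBy T.I {x | ∃ j, j ≠ i₁ ∧ j ≠ i₂ ∧ x = wE i₁ + lam j • wE i₂ - wE j}

end Toupie
namespace Toupie

/-! ### Module-theoretic notions over an arbitrary ring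

Following the paper, all modules are finite-dimensional *right* modules; a right
`A`-module is formalized as a (left) module over `Aᵐᵒᵖ`.  The definitions below are
stated for modules over an arbitrary ring `R` and are applied with `R := Aᵐᵒᵖ`. -/

variable (R : Type u) [Ring R]

/-- A module is indecomposable if it is nonzero and its only idempotent endomorphisms
are `0` and the identity. -/
def Indec (M : ModuleCat.{u} R) : Prop :=
  Nontrivial M ∧ ∀ f : M →ₗ[R] M, f.comp f = f → f = 0 ∨ f = LinearMap.id

/-- Finiteness ("finite dimensionality") of a module. -/
def FdMod (M : ModuleCat.{u} R) : Prop := Module.Finite R M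

/-- `M` has projective dimension at most one: it is the quotient of a projective module
by a projective submodule. -/
def PdLeOne (M : ModuleCat.{u} R) : Prop :=
  ∃ (P : ModuleCat.{u} R) (f : P →ₗ[R] M), Function.Surjective f ∧
    Module.Projective R P ∧ Module.Projective R ↥(LinearMap.ker f)

/-- `M` has injective dimension at most one: it embeds in an injective module with
injective cokernel. -/
def IdLeOne (M : ModuleCat.{u} R) : Prop :=
  ∃ (E : ModuleCat.{u} R) (f : M →ₗ[R] E), Function.Injective f ∧
    Module.Injective R E ∧ Module.Injective R (E ⧸ LinearMap.range f)

/-- One step of a path in `ind R`: a nonzero non-isomorphism between (finite-dimensional)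
indecomposable modules. -/
def Step (M N : ModuleCat.{u} R) : Prop :=
  Indec R M ∧ FdMod R M ∧ Indec R N ∧ FdMod R N ∧
    ∃ f : M →ₗ[R] N, f ≠ 0 ∧ ¬ Function.Bijective f

/-- A path in `ind R` from `M` to `N` (possibly trivial): a chain
`M = M₀ → M₁ → ⋯ → Mₙ = N` of nonzero non-isomorphisms between indecomposables. -/
def IndPath (M N : ModuleCat.{u} R) : Prop := Relation.ReflTransGen (Step R) M N

/-- The left part `L_R`: the indecomposable (finite-dimensional) modules `M` such that
every indecomposable `X` with a path `X ⇝ M` in `ind R` has projective dimension `≤ 1`. -/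
def InLeftPart (M : ModuleCat.{u} R) : Prop :=
  Indec R M ∧ FdMod R M ∧
    ∀ X : ModuleCat.{u} R, Indec R X → FdMod R X → IndPath R X M → PdLeOne R X

/-- The right part `R_R`: the indecomposable (finite-dimensional) modules `M` such that
every indecomposable `X` with a path `M ⇝ X` in `ind R` has injective dimension `≤ 1`. -/
def InRightPart (M : ModuleCat.{u} R) : Prop :=
  Indec R M ∧ FdMod R M ∧
    ∀ X : ModuleCat.{u} R, Indec R X → FdMod R X → IndPath R M X → IdLeOne R X

/-- Hereditary: global dimension at most one, i.e. every module has projective dimension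
at most one. -/
def Hereditary : Prop := ∀ M : ModuleCat.{u} R, PdLeOne R M

/-- Quasitilted: every indecomposable projective module lies in the left part. -/
def Quasitilted : Prop :=
  ∀ P : ModuleCat.{u} R, Indec R P → FdMod R P → Module.Projective R P → InLeftPart R P

/-- A module is directed if it lies on no cycle of nonzero non-isomorphisms between
indecomposables in `ind R`. -/
def Directed (M : ModuleCat.{u} R) : Prop := ¬ Relation.TransGen (Step R) M M

/-- Weakly shod: every indecomposable (finite-dimensional) module not lying in
`L_R ∪ R_R` is directed. -/
def WeaklyShod : Prop :=
  ∀ M : ModuleCat.{u} R, Indec R M → FdMod R M →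
    ¬ InLeftPart R M → ¬ InRightPart R M → Directed R M

/-- Laura: all but finitely many isomorphism classes of indecomposable
(finite-dimensional) modules lie in `L_R ∪ R_R`. -/
def Laura : Prop :=
  ∃ S : Set (ModuleCat.{u} R), S.Finite ∧
    ∀ M : ModuleCat.{u} R, Indec R M → FdMod R M →
      ¬ InLeftPart R M → ¬ InRightPart R M → ∃ N ∈ S, Nonempty (M ≃ₗ[R] N)

/-- There are exactly `n` isomorphism classes of modules satisfying `P`. -/
def NumClasses (P : ModuleCat.{u} R → Prop) (n : ℕ) : Prop :=
  ∃ f : Fin n → ModuleCat.{u} R, (∀ i, P (f i)) ∧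
    (∀ i j, Nonempty ((f i : Type u) ≃ₗ[R] (f j : Type u)) → i = j) ∧
    ∀ M : ModuleCat.{u} R, P M → ∃ i, Nonempty ((M : Type u) ≃ₗ[R] (f i : Type u))

/-- `M` is (isomorphic to) a direct summand of `T`. -/
def IsSummandOf (T : Type u) [AddCommGroup T] [Module R T] (M : ModuleCat.{u} R) : Prop :=
  ∃ N N' : Submodule R T, IsCompl N N' ∧ Nonempty ((M : Type u) ≃ₗ[R] N)

/-- `Ext¹_R(T, T) = 0`: every self-extension `0 → T → E → T → 0` splits. -/
def SelfExtVanish (T : Type u) [AddCommGroup T] [Module R T] : Prop :=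
  ∀ (E : Type u) [AddCommGroup E] [Module R E] (ι : T →ₗ[R] E) (π : E →ₗ[R] T),
    Function.Injective ι → Function.Surjective π → LinearMap.range ι = LinearMap.ker π →
      ∃ s : T →ₗ[R] E, π.comp s = LinearMap.id

/-- A tilting module over a hereditary algebra: a finite module with `Ext¹(T,T) = 0`
having as many pairwise non-isomorphic indecomposable direct summands as there are
simple modules. -/
def IsTiltingMod (T : Type u) [AddCommGroup T] [Module R T] : Prop :=
  Module.Finite R T ∧ SelfExtVanish R T ∧
    ∃ n : ℕ, NumClasses R (fun M => Indec R M ∧ IsSummandOf R T M) n ∧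
      NumClasses R (fun M => IsSimpleModule R M) n

variable (k : Type u) [Field k]

/-- A `k`-algebra `A` is tilted if it is the endomorphism algebra of a tilting (right)
module over a hereditary finite-dimensional `k`-algebra `H`.  (Right `H`-modules are
modules over `Hᵐᵒᵖ`; the isomorphism `A ≅ End_H T` is a `k`-linear ring isomorphism.) -/
def IsTilted (A : Type u) [Ring A] [Algebra k A] : Prop :=
  ∃ (H : Type u) (_ : Ring H) (_ : Algebra k H),
    FiniteDimensional k H ∧ Hereditary Hᵐᵒᵖ ∧
      ∃ (T : Type u) (_ : AddCommGroup T) (_ : Module Hᵐᵒᵖ T),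
        IsTiltingMod Hᵐᵒᵖ T ∧
          ∃ (_ : Module k T) (_ : SMulCommClass Hᵐᵒᵖ k T) (_ : IsScalarTower k Hᵐᵒᵖ T)
            (φ : A ≃+* Module.End Hᵐᵒᵖ T), ∀ (c : k) (x : A), φ (c • x) = c • φ x

end Toupie
namespace Toupie

variable {k : Type u} [Field k] (T : ToupieAlg k)

/-! ### Right `A`-modules as representations of `(Q, I)`

For a right `A`-module `M` (a module over `Aᵐᵒᵖ`) and a vertex `v`, the space of the
corresponding representation at `v` is `M_v = M • e_v`. -/

/-- The action of the idempotent `e_v ∈ A` on a right `A`-module (= `Aᵐᵒᵖ`-module). -/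
def actV (v : Vtx T.t T.ℓ) : (Alg T)ᵐᵒᵖ := op (mkA T (eV v))

/-- The space `M_v = M • e_v` of the representation `M` at the vertex `v` is zero. -/
def VanishAt (M : ModuleCat.{u} (Alg T)ᵐᵒᵖ) (v : Vtx T.t T.ℓ) : Prop :=
  ∀ m : M, actV T v • m = 0

/-- Every simple summand of `top M = M / rad M` is one of the simple modules `S_v`,
`v ∈ vs`: for every maximal submodule `N` the simple quotient `M/N` is supported at some
vertex of `vs` (for an admissible quotient of a path algebra, the simple module `S_v` is
the unique simple on which `e_v` acts nontrivially). -/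
def TopIn (M : ModuleCat.{u} (Alg T)ᵐᵒᵖ) (vs : Set (Vtx T.t T.ℓ)) : Prop :=
  ∀ N : Submodule (Alg T)ᵐᵒᵖ M, IsCoatom N → ∃ v ∈ vs, ∃ m : M, actV T v • m ∉ N

/-- Every simple summand of the socle of `M` is one of the simple modules `S_v`,
`v ∈ vs`: every simple submodule `N ≤ M` is supported at some vertex of `vs`. -/
def SocIn (M : ModuleCat.{u} (Alg T)ᵐᵒᵖ) (vs : Set (Vtx T.t T.ℓ)) : Prop :=
  ∀ N : Submodule (Alg T)ᵐᵒᵖ M, IsAtom N → ∃ v ∈ vs, ∃ m ∈ N, actV T v • m ≠ 0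

/-- The module `D x y` (for two positions `0 ≤ x, y ≤ ℓ i₀` on the unique branch `i₀`
lying in `I`, and an auxiliary branch `i₂ ≠ i₀`): the right `A`-module with generators
`g = e₀` (at the source) and `h = e_y` (at the `y`-th vertex of branch `i₀`), subject to
the relations `g ⬝ (subpath of w i₀ from 0 to x+1) = 0` and
`g ⬝ w i₂ = h ⬝ (subpath of w i₀ from y to ℓ i₀)`.  It is presented as the quotient of
the right regular module `A ⊕ A` by the right submodule generated by
`(1 - e₀, 0)`, `(0, 1 - e_y)`, `(subE i₀ 0 (min (x+1) (ℓ i₀)), 0)` and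
`(w i₂, - subE i₀ y (ℓ i₀))`. -/
abbrev Dmod (i₀ i₂ : Fin T.t) (x y : ℕ) : Type u :=
  (Alg T × Alg T) ⧸ Submodule.span (Alg T)ᵐᵒᵖ
    ({((mkA T (1 - eV Vtx.src) : Alg T), (0 : Alg T)),
      ((0 : Alg T), (mkA T (1 - eV (vtx T.t T.ℓ i₀ y)) : Alg T)),
      ((mkA T (subE i₀ 0 (min (x + 1) (T.ℓ i₀))) : Alg T), (0 : Alg T)),
      ((mkA T (wE i₂) : Alg T), (- mkA T (subE i₀ y (T.ℓ i₀)) : Alg T))} :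
        Set (Alg T × Alg T))

end Toupie

namespace Toupie

/-! ### Combinatorics of vertices and paths -/

section Paths

variable {t : ℕ} {ℓ : Fin t → ℕ}

instance : Finite (Vtx t ℓ) := by
  refine Finite.of_injective
    (β := Option (Option (Σ i : Fin t, Fin (ℓ i - 1))))
    (fun v => match v with
      | .src => none
      | .snk => some none
      | .mid i a => some (some ⟨i, a⟩)) ?_
  intro v w h
  cases v <;> cases w <;> simp_all

instance : Finite (PIdx t ℓ) := by
  refine Finite.of_injective
    (β := Vtx t ℓ ⊕ (Σ i : Fin t, Fin (ℓ i + 1) × Fin (ℓ i + 1)))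
    (fun p => match p with
      | .vert v => Sum.inl v
      | .sub i a b hab hb => Sum.inr ⟨i, ⟨a, by omega⟩, ⟨b, by omega⟩⟩) ?_
  intro p q h
  cases p <;> cases q
  · simpa using h
  · simp at h
  · simp at h
  · simp only [Sum.inr.injEq, Sigma.mk.injEq] at h
    obtain ⟨rfl, h⟩ := h
    simpa using h

instance : Fintype (Vtx t ℓ) := Fintype.ofFinite _

instance : Fintype (PIdx t ℓ) := Fintype.ofFinite _

@[simp] lemma vtx_zero (i : Fin t) : vtx t ℓ i 0 = .src := by simp [vtx]

lemma vtx_mid {i : Fin t} {a : ℕ} (h0 : a ≠ 0) (h : a - 1 < ℓ i - 1) :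
    vtx t ℓ i a = .mid i ⟨a - 1, h⟩ := by simp [vtx, h0, h]

lemma vtx_length {i : Fin t} (h : 1 ≤ ℓ i) : vtx t ℓ i (ℓ i) = .snk := by
  simp [vtx, Nat.one_le_iff_ne_zero.mp h]

lemma vtx_eq_vtx_succ {i i' : Fin t} {a j : ℕ} (ha : a < ℓ i') :
    vtx t ℓ i' a = vtx t ℓ i (j + 1) ↔ i' = i ∧ a = j + 1 := by
  constructor
  · intro h
    unfold vtx at h
    split_ifs at h with h1 h2 h3 h4 h5 <;> first | omega | simp_all
    obtain ⟨rfl, h⟩ := h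
    have := Fin.mk.inj (eq_of_heq h)
    omega
  · rintro ⟨rfl, rfl⟩; rfl

/-- The terminal vertex of a path. -/
def endIdx : PIdx t ℓ → Vtx t ℓ
  | .vert v => v
  | .sub i _ b _ _ => vtx t ℓ i b

end Paths

/-! ### The universal property of the path algebra -/

/-- A representation of the vertices and arrows of the toupie quiver inside a `k`-algebra. -/
structure QuiverRep (k : Type*) [Field k] (t : ℕ) (ℓ : Fin t → ℕ)
    (B : Type*) [Ring B] [Algebra k B] where
  ev : Vtx t ℓ → B
  ar : Fin t → ℕ → B
  ev_mul_ev : ∀ v w, ev v * ev w = if v = w then ev v else 0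
  sum_ev : ∑ v, ev v = 1
  ev_mul_ar : ∀ i j, ev (vtx t ℓ i j) * ar i j = ar i j
  ar_mul_ev : ∀ i j, ar i j * ev (vtx t ℓ i (j + 1)) = ar i j
  ar_eq_zero : ∀ i j, ℓ i ≤ j → ar i j = 0

namespace QuiverRep

variable {k : Type*} [Field k] {t : ℕ} {ℓ : Fin t → ℕ}
  {B : Type*} [Ring B] [Algebra k B] (D : QuiverRep k t ℓ B)

/-- The product of the arrows along branch `i` from position `a` to position `b`. -/
def seg (i : Fin t) (a b : ℕ) : B := ((List.range (b - a)).map fun s => D.ar i (a + s)).prod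

lemma seg_eq_ar_mul {i : Fin t} {a b : ℕ} (h : a < b) :
    D.seg i a b = D.ar i a * D.seg i (a + 1) b := by
  obtain ⟨c, rfl⟩ : ∃ c, b = a + 1 + c := ⟨b - (a + 1), by omega⟩
  have h1 : a + 1 + c - a = c + 1 := by omega
  have h2 : a + 1 + c - (a + 1) = c := by omega
  simp only [seg, h1, h2, List.range_succ_eq_map, List.map_cons, List.prod_cons, List.map_map]
  congr 3
  funext s
  simp only [Function.comp_apply, Nat.succ_eq_add_one]
  congr 1
  omega

lemma seg_eq_mul_ar {i : Fin t} {a b : ℕ} (h : a ≤ b) :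
    D.seg i a (b + 1) = D.seg i a b * D.ar i b := by
  have h1 : b + 1 - a = (b - a) + 1 := by omega
  simp only [seg, h1, List.range_succ, List.map_append, List.prod_append, List.map_cons,
    List.map_nil, List.prod_singleton]
  congr 2
  omega

@[simp] lemma seg_self (i : Fin t) (a : ℕ) : D.seg i a a = 1 := by simp [seg]

lemma seg_succ (i : Fin t) (a : ℕ) : D.seg i a (a + 1) = D.ar i a := by
  rw [seg_eq_mul_ar _ le_rfl, seg_self, one_mul]

lemma seg_mul_seg {i : Fin t} {a b c : ℕ} (hab : a ≤ b) (hbc : b ≤ c) :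
    D.seg i a b * D.seg i b c = D.seg i a c := by
  induction c, hbc using Nat.le_induction with
  | base => simp
  | succ c hbc ih => rw [seg_eq_mul_ar _ hbc, ← mul_assoc, ih, seg_eq_mul_ar _ (hab.trans hbc)]

lemma ev_mul_seg {i : Fin t} {a b : ℕ} (h : a < b) :
    D.ev (vtx t ℓ i a) * D.seg i a b = D.seg i a b := by
  rw [seg_eq_ar_mul _ h, ← mul_assoc, ev_mul_ar]

lemma seg_mul_ev {i : Fin t} {a b : ℕ} (h : a < b) :
    D.seg i a b * D.ev (vtx t ℓ i b) = D.seg i a b := by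
  obtain ⟨b, rfl⟩ : ∃ c, b = c + 1 := ⟨b - 1, by omega⟩
  rw [seg_eq_mul_ar _ (by omega), mul_assoc, ar_mul_ev]

/-- The element of `B` represented by a path. -/
def path : PIdx t ℓ → B
  | .vert v => D.ev v
  | .sub i a b _ _ => D.seg i a b

lemma ev_mul_path (v : Vtx t ℓ) (p : PIdx t ℓ) :
    D.ev v * D.path p = if startIdx p = v then D.path p else 0 := by
  have key : D.path p = D.ev (startIdx p) * D.path p := by
    cases p with
    | vert w => simp [path, startIdx, ev_mul_ev]
    | sub i a b hab hb => exact (D.ev_mul_seg hab).symm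
  rw [key, ← mul_assoc, ev_mul_ev]
  by_cases h : v = startIdx p
  · simp [h]
  · simp [h, Ne.symm h]

lemma path_mul_ev (v : Vtx t ℓ) (p : PIdx t ℓ) :
    D.path p * D.ev v = if endIdx p = v then D.path p else 0 := by
  have key : D.path p = D.path p * D.ev (endIdx p) := by
    cases p with
    | vert w => simp [path, endIdx, ev_mul_ev]
    | sub i a b hab hb => exact (D.seg_mul_ev hab).symm
  rw [key, mul_assoc, ev_mul_ev]
  by_cases h : endIdx p = v <;> simp [h]

/-- The linear extension of `path` to formal combinations of paths. -/
def lin : PSp k t ℓ →ₗ[k] B := Fintype.linearCombination k D.path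

lemma lin_apply (c : PSp k t ℓ) : D.lin c = ∑ p, c p • D.path p := rfl

@[simp] lemma lin_single (p : PIdx t ℓ) : D.lin (Pi.single p 1) = D.path p := by
  simp [lin_apply, Pi.single_apply]

lemma lin_Ev (v : Vtx t ℓ) (c : PSp k t ℓ) : D.lin (Ev k v c) = D.ev v * D.lin c := by
  simp only [lin_apply, Finset.mul_sum, mul_smul_comm, ev_mul_path, Ev]
  refine Finset.sum_congr rfl fun p _ => ?_
  by_cases h : startIdx p = v <;> simp [h]

end QuiverRep

section Prepend

variable {k : Type*} [Field k] {t : ℕ} {ℓ : Fin t → ℕ}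

lemma Ar_single_vert (i : Fin t) (j : ℕ) (v : Vtx t ℓ) :
    Ar k i j (Pi.single (.vert v) 1) =
      if h : j < ℓ i ∧ v = vtx t ℓ i (j + 1) then
        Pi.single (.sub i j (j + 1) (by omega) (by omega)) 1 else 0 := by
  funext p
  change (strip i j p).elim 0 (Pi.single (.vert v) 1 : PSp k t ℓ) = _
  cases p with
  | vert w => split_ifs <;> simp [strip]
  | sub i' a b hab hb =>
    simp only [strip]
    by_cases h1 : i' = i ∧ a = j
    · obtain ⟨rfl, rfl⟩ := h1
      by_cases h2 : a + 1 < b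
      · have h3 : b ≠ a + 1 := by omega
        split_ifs <;> simp [h3]
      · obtain rfl : b = a + 1 := by omega
        have h4 : a < ℓ i' := by omega
        simp [h4, Pi.single_apply, eq_comm]
        split_ifs <;> simp_all
    · rw [dif_neg h1]
      split_ifs with h
      · simp only [Option.elim_none, Pi.single_apply, PIdx.sub.injEq]
        rw [if_neg]
        tauto
      · rfl

lemma Ar_single_sub (i : Fin t) (j : ℕ) (i' : Fin t) (a b : ℕ) (hab : a < b) (hb : b ≤ ℓ i') :
    Ar k i j (Pi.single (.sub i' a b hab hb) 1) =
      if h : i' = i ∧ a = j + 1 then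
        Pi.single (.sub i j b (by omega) (h.1 ▸ hb)) 1 else 0 := by
  funext p
  change (strip i j p).elim 0 (Pi.single (.sub i' a b hab hb) 1 : PSp k t ℓ) = _
  cases p with
  | vert w => split_ifs <;> simp [strip]
  | sub i₁ a₁ b₁ hab₁ hb₁ =>
    simp only [strip]
    by_cases h1 : i₁ = i ∧ a₁ = j
    · obtain ⟨rfl, rfl⟩ := h1
      by_cases h2 : a₁ + 1 < b₁
      · by_cases h3 : i' = i₁ ∧ a = a₁ + 1
        · obtain ⟨rfl, rfl⟩ := h3
          simp [h2, Pi.single_apply]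
        · simp only [h2, dif_pos, and_self, Option.elim_some, dif_neg h3, Pi.single_apply,
            PIdx.sub.injEq, Pi.zero_apply]
          rw [if_neg]
          rintro ⟨rfl, rfl, _⟩
          exact h3 ⟨rfl, rfl⟩
      · by_cases h3 : i' = i₁ ∧ a = a₁ + 1
        · obtain ⟨rfl, rfl⟩ := h3
          have : b₁ ≠ b := by omega
          simp [h2, this]
        · simp [h2, h3]
    · rw [dif_neg h1]
      split_ifs with h
      · simp only [Option.elim_none, Pi.single_apply, PIdx.sub.injEq]
        rw [if_neg]
        tauto
      · rfl

end Prepend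

namespace QuiverRep

variable {k : Type*} [Field k] {t : ℕ} {ℓ : Fin t → ℕ}
  {B : Type*} [Ring B] [Algebra k B] (D : QuiverRep k t ℓ B)

lemma lin_Ar (i : Fin t) (j : ℕ) (c : PSp k t ℓ) : D.lin (Ar k i j c) = D.ar i j * D.lin c := by
  suffices h : D.lin ∘ₗ Ar k i j = LinearMap.mulLeft k (D.ar i j) ∘ₗ D.lin from
    LinearMap.congr_fun h c
  refine LinearMap.pi_ext' fun p => LinearMap.ext_ring ?_
  simp only [LinearMap.comp_apply, LinearMap.single_apply, LinearMap.mulLeft_apply, lin_single]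
  cases p with
  | vert v =>
    rw [Ar_single_vert]
    by_cases hj : j < ℓ i
    · by_cases hv : v = vtx t ℓ i (j + 1)
      · subst hv
        simp [hj, path, seg_succ, ar_mul_ev]
      · simp only [hj, hv, and_false, dif_neg, not_false_eq_true, map_zero, path]
        rw [← D.ar_mul_ev, mul_assoc, ev_mul_ev, if_neg (Ne.symm hv), mul_zero]
    · simp [hj, D.ar_eq_zero i j (by omega)]
  | sub i' a b hab hb =>
    rw [Ar_single_sub]
    by_cases h : i' = i ∧ a = j + 1
    · obtain ⟨rfl, rfl⟩ := h
      simp [path, D.seg_eq_ar_mul (show j < b by omega)]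
    · rw [dif_neg h, map_zero, ← D.ar_mul_ev, mul_assoc, ev_mul_path, if_neg, mul_zero]
      rwa [startIdx, vtx_eq_vtx_succ (by omega)]

/-- The sum of all trivial paths. -/
def _root_.Toupie.vertSum (k : Type*) [Field k] (t : ℕ) (ℓ : Fin t → ℕ) : PSp k t ℓ :=
  ∑ v, Pi.single (.vert v) 1

lemma lin_vertSum : D.lin (vertSum k t ℓ) = 1 := by
  simp [vertSum, path, D.sum_ev]

lemma lin_apply_apply {x : Module.End k (PSp k t ℓ)} (hx : x ∈ PathAlg k t ℓ) (c : PSp k t ℓ) :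
    D.lin (x c) = D.lin (x (vertSum k t ℓ)) * D.lin c := by
  induction hx using Algebra.adjoin_induction generalizing c with
  | mem x hx =>
    rcases hx with ⟨v, rfl⟩ | ⟨i, j, rfl⟩
    · simp [lin_Ev, lin_vertSum]
    · simp [lin_Ar, lin_vertSum]
  | algebraMap r => simp [Module.algebraMap_end_apply, lin_vertSum]
  | add x y _ _ hx hy => simp [hx c, hy c, add_mul]
  | mul x y _ _ hx hy =>
    rw [Module.End.mul_apply, Module.End.mul_apply, hx, hy c, hx (y _), mul_assoc]

/-- The algebra homomorphism from the path algebra determined by the images of the vertices and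
the arrows. -/
def lift : PathAlg k t ℓ →ₐ[k] B :=
  AlgHom.ofLinearMap
    (D.lin ∘ₗ LinearMap.applyₗ (vertSum k t ℓ) ∘ₗ (PathAlg k t ℓ).val.toLinearMap)
    (by simp [lin_vertSum])
    (fun x y => by simpa using D.lin_apply_apply x.2 ((y : Module.End k _) (vertSum k t ℓ)))

lemma lift_apply (x : PathAlg k t ℓ) :
    D.lift x = D.lin ((x : Module.End k (PSp k t ℓ)) (vertSum k t ℓ)) := rfl

@[simp] lemma lift_eV (v : Vtx t ℓ) : D.lift (eV v) = D.ev v := by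
  simp [lift_apply, eV, lin_Ev, lin_vertSum]

@[simp] lemma lift_arE (i : Fin t) (j : ℕ) : D.lift (arE i j) = D.ar i j := by
  simp [lift_apply, arE, lin_Ar, lin_vertSum]

@[simp] lemma lift_subE (i : Fin t) (a b : ℕ) : D.lift (subE i a b) = D.seg i a b := by
  simp [subE, seg, map_list_prod, List.map_map, Function.comp_def]

end QuiverRep

/-! ### The path algebra -/

section PathAlgebra

variable (k : Type*) [Field k] (t : ℕ) (ℓ : Fin t → ℕ)

/-- The vertices and arrows inside the path algebra. -/
def univRep : QuiverRep k t ℓ (PathAlg k t ℓ) where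
  ev := eV
  ar := arE
  ev_mul_ev v w := by
    refine Subtype.ext (LinearMap.ext fun c => funext fun p => ?_)
    by_cases h : v = w
    · subst h
      by_cases h1 : startIdx p = v <;> simp [eV, Ev, h1]
    · by_cases h1 : startIdx p = v
      · subst h1; simp [eV, Ev, h]
      · simp [eV, Ev, h, h1]
  sum_ev := by
    refine Subtype.ext (LinearMap.ext fun c => funext fun p => ?_)
    simp [eV, Ev]
  ev_mul_ar i j := by
    refine Subtype.ext (LinearMap.ext fun c => funext fun p => ?_)
    cases p with
    | vert w => simp [eV, arE, Ev, Ar, strip]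
    | sub i' a b hab hb =>
      by_cases h1 : i' = i ∧ a = j
      · obtain ⟨rfl, rfl⟩ := h1
        simp [eV, arE, Ev, Ar, startIdx]
      · simp [eV, arE, Ev, Ar, strip, h1]
  ar_mul_ev i j := by
    refine Subtype.ext (LinearMap.ext fun c => funext fun p => ?_)
    cases p with
    | vert w => simp [eV, arE, Ev, Ar, strip]
    | sub i' a b hab hb =>
      by_cases h1 : i' = i ∧ a = j
      · obtain ⟨rfl, rfl⟩ := h1
        by_cases h2 : a + 1 < b
        · simp [eV, arE, Ev, Ar, strip, h2, startIdx]
        · obtain rfl : b = a + 1 := by omega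
          simp [eV, arE, Ev, Ar, strip, startIdx]
      · simp [eV, arE, Ev, Ar, strip, h1]
  ar_eq_zero i j h := by
    refine Subtype.ext (LinearMap.ext fun c => funext fun p => ?_)
    cases p with
    | vert w => simp [arE, Ar, strip]
    | sub i' a b hab hb =>
      have h1 : ¬ (i' = i ∧ a = j) := by rintro ⟨rfl, rfl⟩; omega
      simp [arE, Ar, strip, h1]

variable {k t ℓ}

lemma univRep_seg (i : Fin t) (a b : ℕ) : (univRep k t ℓ).seg i a b = subE i a b := rfl

lemma univRep_lift : (univRep k t ℓ).lift = AlgHom.id k (PathAlg k t ℓ) := by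
  refine AlgHom.adjoin_ext ?_
  rintro x (⟨v, rfl⟩ | ⟨i, j, rfl⟩)
  · exact (univRep k t ℓ).lift_eV v
  · exact (univRep k t ℓ).lift_arE i j

/-- The coefficient of the path `p` in an element of the path algebra. -/
def coeff (p : PIdx t ℓ) : PathAlg k t ℓ →ₗ[k] k :=
  LinearMap.proj p ∘ₗ LinearMap.applyₗ (vertSum k t ℓ) ∘ₗ (PathAlg k t ℓ).val.toLinearMap

lemma eq_sum_coeff (x : PathAlg k t ℓ) : x = ∑ p, coeff p x • (univRep k t ℓ).path p :=
  (AlgHom.congr_fun univRep_lift x).symm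

lemma subE_apply_vertSum {i : Fin t} {a b : ℕ} (hab : a < b) (hb : b ≤ ℓ i) :
    (subE i a b : PathAlg k t ℓ).1 (vertSum k t ℓ) = Pi.single (.sub i a b hab hb) 1 := by
  obtain ⟨n, rfl⟩ : ∃ n, b = a + n + 1 := ⟨b - a - 1, by omega⟩
  induction n generalizing a with
  | zero =>
    rw [← univRep_seg, QuiverRep.seg_succ]
    change Ar k i a (∑ v, Pi.single (.vert v) 1) = _
    rw [map_sum, Finset.sum_eq_single (vtx t ℓ i (a + 1))]
    · rw [Ar_single_vert, dif_pos ⟨by omega, rfl⟩]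
    · intro v _ hv
      rw [Ar_single_vert, dif_neg (fun h => hv h.2)]
    · simp
  | succ n ih =>
    have h := ih (a := a + 1) (by omega) (by omega)
    rw [← univRep_seg, QuiverRep.seg_eq_ar_mul _ hab]
    change Ar k i a ((subE i (a + 1) _ : PathAlg k t ℓ).1 (vertSum k t ℓ)) = _
    have e : a + (n + 1) + 1 = a + 1 + n + 1 := by omega
    simp only [e, h, Ar_single_sub]
    simp

lemma coeff_subE (p : PIdx t ℓ) {i : Fin t} {a b : ℕ} (hab : a < b) (hb : b ≤ ℓ i) :
    coeff (k := k) p (subE i a b) = if p = .sub i a b hab hb then 1 else 0 := by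
  change (subE i a b : PathAlg k t ℓ).1 (vertSum k t ℓ) p = _
  rw [subE_apply_vertSum hab hb, Pi.single_apply]

end PathAlgebra

end Toupie

namespace Toupie

section PathCombinatorics

variable {t : ℕ} {ℓ : Fin t → ℕ}

lemma vtx_inj {i i' : Fin t} {a b : ℕ} (ha : a < ℓ i) (hb : b ≠ 0)
    (h : vtx t ℓ i a = vtx t ℓ i' b) : i = i' ∧ a = b := by
  obtain ⟨b, rfl⟩ := Nat.exists_eq_succ_of_ne_zero hb
  exact (vtx_eq_vtx_succ ha).1 h

lemma vtx_ne_src {i : Fin t} {a : ℕ} (ha : a ≠ 0) : vtx t ℓ i a ≠ .src := by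
  unfold vtx
  split_ifs <;> simp_all

lemma vtx_ne_snk {i : Fin t} {a : ℕ} (ha : a < ℓ i) : vtx t ℓ i a ≠ .snk := by
  unfold vtx
  split_ifs <;> first | omega | simp

lemma vtx_ne_vtx {i : Fin t} {a b : ℕ} (hab : a < b) (hb : b ≤ ℓ i) :
    vtx t ℓ i a ≠ vtx t ℓ i b := fun h => by
  have := vtx_inj (by omega) (by omega) h
  omega

lemma eq_length_of_vtx_eq_snk {i : Fin t} {b : ℕ} (hb : b ≤ ℓ i)
    (h : vtx t ℓ i b = .snk) : b = ℓ i := by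
  by_contra hne
  exact vtx_ne_snk (by omega) h

/-- Apart from the branches, a path is determined by its endpoints. -/
lemma path_ext {p q : PIdx t ℓ} (hs : startIdx p = startIdx q) (he : endIdx p = endIdx q)
    (h : ¬ (startIdx p = .src ∧ endIdx p = .snk)) : p = q := by
  cases p with
  | vert v =>
    cases q with
    | vert w => simpa [startIdx] using hs
    | sub i a b hab hb => exact absurd (hs.symm.trans he) (vtx_ne_vtx hab hb)
  | sub i a b hab hb =>
    cases q with
    | vert w => exact absurd (hs.trans he.symm) (vtx_ne_vtx hab hb)
    | sub i' a' b' hab' hb' =>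
      simp only [startIdx, endIdx] at hs he h
      have hi : i = i' ∧ a = a' := by
        by_cases ha' : a' = 0
        · subst ha'
          have ha : a = 0 := by
            by_contra ha
            exact vtx_ne_src ha (hs.trans (vtx_zero i'))
          subst ha
          have hbl : b < ℓ i := by
            rcases hb.lt_or_eq with h' | rfl
            · exact h'
            · exact absurd ⟨vtx_zero i, vtx_length (by omega)⟩ h
          exact ⟨(vtx_inj hbl (by omega) he).1, rfl⟩
        · exact vtx_inj (by omega) ha' hs
      obtain ⟨rfl, rfl⟩ := hi
      have hbb : b = b' := by
        rcases hb.lt_or_eq with h' | rfl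
        · exact (vtx_inj h' (by omega) he).2
        · rw [vtx_length (by omega)] at he
          exact (eq_length_of_vtx_eq_snk hb' he.symm).symm
      subst hbb
      rfl

end PathCombinatorics

namespace QuiverRep

variable {k : Type*} [Field k] {t : ℕ} {ℓ : Fin t → ℕ}
  {B : Type*} [Ring B] [Algebra k B]

/-- The image of a representation under a homomorphism of algebras. -/
def map {C : Type*} [Ring C] [Algebra k C] (D : QuiverRep k t ℓ B) (φ : B →ₐ[k] C) :
    QuiverRep k t ℓ C where
  ev v := φ (D.ev v)
  ar i j := φ (D.ar i j)
  ev_mul_ev v w := by rw [← map_mul, D.ev_mul_ev]; split_ifs <;> simp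
  sum_ev := by rw [← map_sum, D.sum_ev, map_one]
  ev_mul_ar i j := by rw [← map_mul, D.ev_mul_ar]
  ar_mul_ev i j := by rw [← map_mul, D.ar_mul_ev]
  ar_eq_zero i j h := by rw [D.ar_eq_zero i j h, map_zero]

lemma map_seg {C : Type*} [Ring C] [Algebra k C] (D : QuiverRep k t ℓ B) (φ : B →ₐ[k] C)
    (i : Fin t) (a b : ℕ) : (D.map φ).seg i a b = φ (D.seg i a b) := by
  simp [seg, map, map_list_prod, List.map_map, Function.comp_def]

lemma map_path {C : Type*} [Ring C] [Algebra k C] (D : QuiverRep k t ℓ B) (φ : B →ₐ[k] C)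
    (p : PIdx t ℓ) : (D.map φ).path p = φ (D.path p) := by
  cases p
  · rfl
  · exact map_seg D φ _ _ _

variable (D : QuiverRep k t ℓ B)

/-- Every element of `B` is a linear combination of paths. -/
def Spans : Prop := ∀ x : B, ∃ c : PIdx t ℓ → k, x = ∑ p, c p • D.path p

variable {D}

lemma mul_ev_mem (hD : D.Spans) (x : B) (v : Vtx t ℓ) :
    x * D.ev v ∈ Submodule.span k (D.path '' {p | endIdx p = v}) := by
  obtain ⟨c, rfl⟩ := hD x
  rw [Finset.sum_mul]
  refine Submodule.sum_mem _ fun p _ => ?_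
  rw [smul_mul_assoc, path_mul_ev]
  split_ifs with h
  · exact Submodule.smul_mem _ _ (Submodule.subset_span ⟨p, h, rfl⟩)
  · simp

lemma ev_mul_mem (hD : D.Spans) (x : B) (v : Vtx t ℓ) :
    D.ev v * x ∈ Submodule.span k (D.path '' {p | startIdx p = v}) := by
  obtain ⟨c, rfl⟩ := hD x
  rw [Finset.mul_sum]
  refine Submodule.sum_mem _ fun p _ => ?_
  rw [mul_smul_comm, ev_mul_path]
  split_ifs with h
  · exact Submodule.smul_mem _ _ (Submodule.subset_span ⟨p, h, rfl⟩)
  · simp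

lemma ev_mul_mul_ev_mem (hD : D.Spans) (x : B) (u v : Vtx t ℓ) :
    D.ev u * x * D.ev v ∈
      Submodule.span k (D.path '' {p | startIdx p = u ∧ endIdx p = v}) := by
  obtain ⟨c, rfl⟩ := hD x
  rw [Finset.mul_sum, Finset.sum_mul]
  refine Submodule.sum_mem _ fun p _ => ?_
  rw [mul_smul_comm, ev_mul_path, smul_mul_assoc]
  split_ifs with h
  · rw [path_mul_ev]
    split_ifs with h'
    · exact Submodule.smul_mem _ _ (Submodule.subset_span ⟨p, ⟨h, h'⟩, rfl⟩)
    · simp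
  · simp

lemma mul_ev_src (hD : D.Spans) (x : B) : ∃ c : k, x * D.ev .src = c • D.ev .src := by
  have h : x * D.ev .src ∈ Submodule.span k {D.ev .src} := by
    refine Submodule.span_mono ?_ (mul_ev_mem hD x .src)
    rintro _ ⟨p, hp, rfl⟩
    cases p with
    | vert v => obtain rfl : v = .src := hp; rfl
    | sub i a b hab hb => exact absurd hp (vtx_ne_src (by omega))
  obtain ⟨c, hc⟩ := Submodule.mem_span_singleton.1 h
  exact ⟨c, hc.symm⟩

lemma ev_snk_mul (hD : D.Spans) (x : B) : ∃ c : k, D.ev .snk * x = c • D.ev .snk := by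
  have h : D.ev .snk * x ∈ Submodule.span k {D.ev .snk} := by
    refine Submodule.span_mono ?_ (ev_mul_mem hD x .snk)
    rintro _ ⟨p, hp, rfl⟩
    cases p with
    | vert v => obtain rfl : v = .snk := hp; rfl
    | sub i a b hab hb => exact absurd hp (vtx_ne_snk (by omega))
  obtain ⟨c, hc⟩ := Submodule.mem_span_singleton.1 h
  exact ⟨c, hc.symm⟩

lemma mul_ev_one (hD : D.Spans) (x : B) {i : Fin t} (hi : 2 ≤ ℓ i) :
    ∃ c d : k, x * D.ev (vtx t ℓ i 1) = c • D.ev (vtx t ℓ i 1) + d • D.ar i 0 := by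
  have h : x * D.ev (vtx t ℓ i 1) ∈ Submodule.span k {D.ev (vtx t ℓ i 1), D.ar i 0} := by
    refine Submodule.span_mono ?_ (mul_ev_mem hD x _)
    rintro _ ⟨p, hp, rfl⟩
    cases p with
    | vert v => obtain rfl : v = vtx t ℓ i 1 := hp; exact Or.inl rfl
    | sub i' a b hab hb =>
      obtain ⟨rfl, rfl⟩ := vtx_inj (by omega) (by omega) (Eq.symm hp)
      obtain rfl : a = 0 := by omega
      exact Or.inr (D.seg_succ _ _)
  obtain ⟨c, d, hc⟩ := Submodule.mem_span_pair.1 h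
  exact ⟨c, d, hc.symm⟩

lemma ev_pred_mul (hD : D.Spans) (x : B) {i : Fin t} (hi : 2 ≤ ℓ i) :
    ∃ c d : k, D.ev (vtx t ℓ i (ℓ i - 1)) * x =
      c • D.ev (vtx t ℓ i (ℓ i - 1)) + d • D.ar i (ℓ i - 1) := by
  have h : D.ev (vtx t ℓ i (ℓ i - 1)) * x ∈
      Submodule.span k {D.ev (vtx t ℓ i (ℓ i - 1)), D.ar i (ℓ i - 1)} := by
    refine Submodule.span_mono ?_ (ev_mul_mem hD x _)
    rintro _ ⟨p, hp, rfl⟩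
    cases p with
    | vert v => obtain rfl : v = vtx t ℓ i (ℓ i - 1) := hp; exact Or.inl rfl
    | sub i' a b hab hb =>
      obtain ⟨rfl, rfl⟩ := vtx_inj (by omega) (by omega) hp
      obtain rfl : b = (ℓ i' - 1) + 1 := by omega
      exact Or.inr (D.seg_succ _ _)
  obtain ⟨c, d, hc⟩ := Submodule.mem_span_pair.1 h
  exact ⟨c, d, hc.symm⟩

end QuiverRep

lemma univRep_spans {k : Type*} [Field k] {t : ℕ} {ℓ : Fin t → ℕ} : (univRep k t ℓ).Spans :=
  fun x => ⟨fun p => coeff p x, eq_sum_coeff x⟩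

/-! ### The quotient algebra -/

section Quotient

variable {k : Type u} [Field k] (T : ToupieAlg k)

lemma mkA_eq_zero {x : PathAlg k T.t T.ℓ} : mkA T x = 0 ↔ x ∈ T.I := by
  rw [TwoSidedIdeal.mem_iff, ← RingCon.eq]
  rfl

/-- The quotient map as a homomorphism of algebras. -/
def mkAlg : PathAlg k T.t T.ℓ →ₐ[k] Alg T := { mkA T with commutes' := fun _ => rfl }

@[simp] lemma mkAlg_apply (x : PathAlg k T.t T.ℓ) : mkAlg T x = mkA T x := rfl

lemma mkAlg_eq_zero {x : PathAlg k T.t T.ℓ} : mkAlg T x = 0 ↔ x ∈ T.I := mkA_eq_zero T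

/-- The vertices and arrows inside the toupie algebra. -/
def algRep : QuiverRep k T.t T.ℓ (Alg T) := (univRep k T.t T.ℓ).map (mkAlg T)

lemma algRep_seg (i : Fin T.t) (a b : ℕ) : (algRep T).seg i a b = mkA T (subE i a b) :=
  QuiverRep.map_seg _ _ _ _ _

lemma algRep_path (p : PIdx T.t T.ℓ) :
    (algRep T).path p = mkAlg T ((univRep k T.t T.ℓ).path p) :=
  QuiverRep.map_path _ _ _

lemma algRep_spans : (algRep T).Spans := by
  intro x
  obtain ⟨y, rfl⟩ := mkA_surjective T x
  obtain ⟨c, hc⟩ := univRep_spans y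
  refine ⟨c, ?_⟩
  rw [← mkAlg_apply, hc, map_sum]
  exact Finset.sum_congr rfl fun p _ => by rw [map_smul, algRep_path]

variable {T}

lemma wE_notMem (hsc : SimplyConnected T) (i : Fin T.t) : wE i ∉ T.I := by
  intro hi
  have : Nontrivial (Fin T.t) := Fin.nontrivial_iff_two_le.2 T.ht
  obtain ⟨j, hj⟩ := exists_ne i
  obtain ⟨J, lam, ⟨hcard, -, -, hmin⟩, hiJ, hjJ⟩ := hsc i j hj.symm
  refine hmin {i} ?_ (Finset.singleton_nonempty i) ?_
  · refine (Finset.ssubset_iff_of_subset (Finset.singleton_subset_iff.2 hiJ)).2 ⟨j, hjJ, ?_⟩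
    simpa using hj
  · rw [Finset.sum_singleton, ← mkAlg_eq_zero, map_smul, (mkAlg_eq_zero T).2 hi, smul_zero]

lemma two_le_length (hsc : SimplyConnected T) (i : Fin T.t) : 2 ≤ T.ℓ i := by
  by_contra hlt
  have hl : 0 < T.ℓ i := T.hℓ i
  have : Nontrivial (Fin T.t) := Fin.nontrivial_iff_two_le.2 T.ht
  obtain ⟨j, hj⟩ := exists_ne i
  obtain ⟨J, lam, ⟨-, hne, hmem, -⟩, hiJ, -⟩ := hsc i j hj.symm
  set p : PIdx T.t T.ℓ := .sub i 0 (T.ℓ i) hl le_rfl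
  have h0 : coeff p (∑ j ∈ J, lam j • wE j : PathAlg k T.t T.ℓ) = 0 := by
    have hle : Submodule.span k {y : PathAlg k T.t T.ℓ | ∃ i a b, a + 2 ≤ b ∧ b ≤ T.ℓ i ∧
        y = subE i a b} ≤ LinearMap.ker (coeff p) := by
      refine Submodule.span_le.2 ?_
      rintro _ ⟨i', a, b, hab, hb, rfl⟩
      rw [SetLike.mem_coe, LinearMap.mem_ker, coeff_subE p (by omega) hb, if_neg]
      rintro h
      obtain ⟨rfl, rfl, rfl⟩ := PIdx.sub.inj h
      omega
    exact hle (T.adm _ hmem)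
  have h1 : coeff p (∑ j ∈ J, lam j • wE j : PathAlg k T.t T.ℓ) = lam i := by
    rw [map_sum, Finset.sum_eq_single_of_mem i hiJ]
    · rw [map_smul, wE, coeff_subE p hl le_rfl, if_pos rfl, smul_eq_mul, mul_one]
    · intro j _ hji
      rw [map_smul, wE, coeff_subE p (T.hℓ j) le_rfl, if_neg, smul_zero]
      intro h
      exact hji (PIdx.sub.inj h).1.symm
  exact hne i hiJ (h1.symm.trans h0)

lemma exists_wE_eq (p : PIdx T.t T.ℓ) :
    ∃ i l r, (wE i : PathAlg k T.t T.ℓ) = l * (univRep k T.t T.ℓ).path p * r := by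
  set D := univRep k T.t T.ℓ
  have key : ∀ i a b, a ≤ b → b ≤ T.ℓ i →
      (wE i : PathAlg k T.t T.ℓ) = D.seg i 0 a * D.seg i a b * D.seg i b (T.ℓ i) := by
    intro i a b hab hb
    rw [D.seg_mul_seg (Nat.zero_le _) hab, D.seg_mul_seg (Nat.zero_le _) hb]
    rfl
  have hseg : ∀ i, D.seg i 0 (T.ℓ i) = wE i := fun i => rfl
  have i₀ : Fin T.t := ⟨0, by have := T.ht; omega⟩
  cases p with
  | vert v =>
    cases v with
    | src =>
      refine ⟨i₀, 1, wE i₀, ?_⟩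
      rw [one_mul, ← hseg, QuiverRep.path, ← vtx_zero i₀, D.ev_mul_seg (T.hℓ i₀)]
    | snk =>
      refine ⟨i₀, wE i₀, 1, ?_⟩
      rw [mul_one, ← hseg, QuiverRep.path, ← vtx_length (T.hℓ i₀), D.seg_mul_ev (T.hℓ i₀)]
    | mid i a =>
      have ha : (a : ℕ) < T.ℓ i - 1 := a.2
      refine ⟨i, D.seg i 0 (a + 1), D.seg i (a + 1) (T.ℓ i), ?_⟩
      have hv : Vtx.mid i a = vtx T.t T.ℓ i (a + 1) :=
        (vtx_mid (Nat.succ_ne_zero _) (by simp)).symm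
      rw [QuiverRep.path, hv, D.seg_mul_ev (by omega),
        D.seg_mul_seg (Nat.zero_le _) (by omega), hseg]
  | sub i a b hab hb => exact ⟨i, _, _, key i a b hab.le hb⟩

lemma algRep_path_ne_zero (hsc : SimplyConnected T) (p : PIdx T.t T.ℓ) :
    (algRep T).path p ≠ 0 := by
  intro h
  obtain ⟨i, l, r, hi⟩ := exists_wE_eq (k := k) p
  refine wE_notMem hsc i ((mkAlg_eq_zero T).1 ?_)
  rw [hi, map_mul, map_mul, ← algRep_path, h, mul_zero, zero_mul]

lemma algRep_seg_ne_zero (hsc : SimplyConnected T) {i : Fin T.t} {a b : ℕ} (hab : a < b)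
    (hb : b ≤ T.ℓ i) : (algRep T).seg i a b ≠ 0 :=
  algRep_path_ne_zero hsc (.sub i a b hab hb)

lemma algRep_ar_ne_zero (hsc : SimplyConnected T) {i : Fin T.t} {a : ℕ} (ha : a < T.ℓ i) :
    (algRep T).ar i a ≠ 0 := by
  rw [← QuiverRep.seg_succ]
  exact algRep_seg_ne_zero hsc (by omega) ha

/-- The ideal of a simply connected toupie algebra consists of linear combinations of
branches. -/
lemma mem_span_wE (hsc : SimplyConnected T) {x : PathAlg k T.t T.ℓ} (hx : x ∈ T.I) :
    x ∈ Submodule.span k (Set.range wE) := by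
  set D := univRep k T.t T.ℓ
  have hx' : x = ∑ u, ∑ v, D.ev u * x * D.ev v := by
    simp_rw [← Finset.mul_sum, D.sum_ev, mul_one, ← Finset.sum_mul, D.sum_ev, one_mul]
  rw [hx']
  refine Submodule.sum_mem _ fun u _ => Submodule.sum_mem _ fun v _ => ?_
  have hI : D.ev u * x * D.ev v ∈ T.I := T.I.mul_mem_right _ _ (T.I.mul_mem_left _ _ hx)
  have hmem := QuiverRep.ev_mul_mul_ev_mem univRep_spans x u v
  by_cases huv : u = .src ∧ v = .snk
  · obtain ⟨rfl, rfl⟩ := huv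
    refine Submodule.span_mono ?_ hmem
    rintro _ ⟨p, ⟨hs, he⟩, rfl⟩
    cases p with
    | vert w =>
      obtain rfl : w = .src := hs
      cases he
    | sub i a b hab hb =>
      obtain rfl : a = 0 := by
        by_contra ha
        exact vtx_ne_src ha hs
      obtain rfl := eq_length_of_vtx_eq_snk hb he
      exact ⟨i, rfl⟩
  · suffices h : D.ev u * x * D.ev v = 0 by rw [h]; exact Submodule.zero_mem _
    by_cases hp : ∃ p : PIdx T.t T.ℓ, startIdx p = u ∧ endIdx p = v
    · obtain ⟨p, rfl, rfl⟩ := hp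
      have hset : {q : PIdx T.t T.ℓ | startIdx q = startIdx p ∧ endIdx q = endIdx p} = {p} := by
        ext q
        constructor
        · rintro ⟨h1, h2⟩
          exact (path_ext h1.symm h2.symm huv).symm
        · rintro rfl
          exact ⟨rfl, rfl⟩
      rw [hset, Set.image_singleton] at hmem
      obtain ⟨c, hc⟩ := Submodule.mem_span_singleton.1 hmem
      rw [← hc, ← mkAlg_eq_zero, map_smul, ← algRep_path] at hI
      rcases smul_eq_zero.1 hI with h0 | h0
      · rw [← hc, h0, zero_smul]
      · exact absurd h0 (algRep_path_ne_zero hsc p)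
    · have hset : {q : PIdx T.t T.ℓ | startIdx q = u ∧ endIdx q = v} = ∅ := by
        ext q
        simpa using fun h1 h2 => hp ⟨q, h1, h2⟩
      rw [hset, Set.image_empty, Submodule.span_empty] at hmem
      exact hmem

/-! ### Relations in the regular module -/

lemma eq_zero_of_mul_ar_eq_zero (hsc : SimplyConnected T) {i : Fin T.t} {a : Alg T}
    (ha : a * (algRep T).ev .src = a) (h : a * (algRep T).ar i 0 = 0) : a = 0 := by
  obtain ⟨c, hc⟩ := QuiverRep.mul_ev_src (algRep_spans T) a
  rw [ha] at hc
  rw [hc, smul_mul_assoc, ← vtx_zero i, QuiverRep.ev_mul_ar] at h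
  rcases smul_eq_zero.1 h with h0 | h0
  · rw [hc, h0, zero_smul]
  · exact absurd h0 (algRep_ar_ne_zero hsc (T.hℓ i))

lemma ev_snk_mul_eq_zero (hsc : SimplyConnected T) {i : Fin T.t} {a : Alg T}
    (h : (algRep T).ar i (T.ℓ i - 1) * a = 0) : (algRep T).ev .snk * a = 0 := by
  have hl := T.hℓ i
  obtain ⟨c, hc⟩ := QuiverRep.ev_snk_mul (algRep_spans T) a
  have he := (algRep T).ar_mul_ev i (T.ℓ i - 1)
  rw [Nat.sub_add_cancel hl, vtx_length hl] at he
  rw [← he, mul_assoc, hc, mul_smul_comm, he] at h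
  rcases smul_eq_zero.1 h with h0 | h0
  · rw [hc, h0, zero_smul]
  · exact absurd h0 (algRep_ar_ne_zero hsc (by omega))

lemma exists_eq_smul_ar_zero (hsc : SimplyConnected T) {a : Fin T.t → Alg T}
    (ha : ∀ i, a i * (algRep T).ev (vtx T.t T.ℓ i 1) = a i)
    (h : ∑ i, a i * (algRep T).seg i 1 (T.ℓ i) = 0) (i : Fin T.t) :
    ∃ d : k, a i = d • (algRep T).ar i 0 := by
  set D := algRep T
  have hsum : ∑ j, D.ev (vtx T.t T.ℓ i 1) * (a j * D.seg j 1 (T.ℓ j)) = 0 := by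
    rw [← Finset.mul_sum, h, mul_zero]
  choose c d hcd using fun j => QuiverRep.mul_ev_one (algRep_spans T) (a j) (two_le_length hsc j)
  replace hcd := fun j => (ha j).symm.trans (hcd j)
  have har : ∀ j, D.ev (vtx T.t T.ℓ i 1) * D.ar j 0 = 0 := fun j => by
    rw [← D.ev_mul_ar, vtx_zero, ← mul_assoc, D.ev_mul_ev, if_neg (vtx_ne_src one_ne_zero),
      zero_mul]
  have hmul : ∀ j, D.ev (vtx T.t T.ℓ i 1) * a j =
      if j = i then c i • D.ev (vtx T.t T.ℓ i 1) else 0 := fun j => by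
    rw [hcd j, mul_add, mul_smul_comm, mul_smul_comm, har, smul_zero, add_zero, D.ev_mul_ev]
    by_cases hij : j = i
    · subst hij; simp
    · rw [if_neg hij, if_neg, smul_zero]
      intro he
      exact hij (vtx_inj (two_le_length hsc i) one_ne_zero he).1.symm
  rw [Finset.sum_eq_single i (fun j _ hj => by rw [← mul_assoc, hmul, if_neg hj, zero_mul])
    (by simp), ← mul_assoc, hmul, if_pos rfl, smul_mul_assoc,
    D.ev_mul_seg (two_le_length hsc i)] at hsum
  refine ⟨d i, ?_⟩
  rcases smul_eq_zero.1 hsum with h0 | h0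
  · rw [hcd i, h0, zero_smul, zero_add]
  · exact absurd h0 (algRep_seg_ne_zero hsc (two_le_length hsc i) le_rfl)

lemma exists_ev_mul_eq_smul_ar (hsc : SimplyConnected T) {a : Fin T.t → Alg T}
    (h : ∑ i, (algRep T).seg i 0 (T.ℓ i - 1) * a i = 0) (i : Fin T.t) :
    ∃ d : k, (algRep T).ev (vtx T.t T.ℓ i (T.ℓ i - 1)) * a i =
      d • (algRep T).ar i (T.ℓ i - 1) := by
  set D := algRep T
  set b : Fin T.t → Vtx T.t T.ℓ := fun j => vtx T.t T.ℓ j (T.ℓ j - 1)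
  have hl := two_le_length hsc
  have hsum : ∑ j, D.seg j 0 (T.ℓ j - 1) * a j * D.ev (b i) = 0 := by
    rw [← Finset.sum_mul, h, zero_mul]
  choose c d hcd using fun j => QuiverRep.ev_pred_mul (algRep_spans T) (a j) (hl j)
  have har : ∀ j, D.ar j (T.ℓ j - 1) * D.ev (b i) = 0 := fun j => by
    have := hl i
    rw [← D.ar_mul_ev, Nat.sub_add_cancel (T.hℓ j), vtx_length (T.hℓ j), mul_assoc, D.ev_mul_ev,
      if_neg (vtx_ne_snk (by omega)).symm, mul_zero]
  have hmul : ∀ j, D.ev (b j) * a j * D.ev (b i) =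
      if j = i then c i • D.ev (b i) else 0 := fun j => by
    rw [hcd j, add_mul, smul_mul_assoc, smul_mul_assoc, har, smul_zero, add_zero, D.ev_mul_ev]
    by_cases hij : j = i
    · subst hij; simp [b]
    · rw [if_neg hij, if_neg, smul_zero]
      intro he
      have h1 := hl i
      have h2 := hl j
      exact hij (vtx_inj (by omega) (by omega) he).1
  have hseg : ∀ j, D.seg j 0 (T.ℓ j - 1) * a j * D.ev (b i) =
      D.seg j 0 (T.ℓ j - 1) * (D.ev (b j) * a j * D.ev (b i)) := fun j => by
    have := hl j
    rw [← mul_assoc, ← mul_assoc, D.seg_mul_ev (by omega)]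
  have hi := hl i
  rw [Finset.sum_eq_single i (fun j _ hj => by rw [hseg, hmul, if_neg hj, mul_zero])
    (by simp), hseg, hmul, if_pos rfl, mul_smul_comm, D.seg_mul_ev (by omega)] at hsum
  refine ⟨d i, ?_⟩
  rcases smul_eq_zero.1 hsum with h0 | h0
  · rw [hcd i, h0, zero_smul, zero_add]
  · exact absurd h0 (algRep_seg_ne_zero hsc (by omega) (by omega))

end Quotient

end Toupie

namespace Toupie

/-- Linear functionals on the space `e₀ A e∞`, restricted to the branches, together with two
relations between branches which are orthogonal to a pair of these functionals. -/
structure BranchData {k : Type u} [Field k] (T : ToupieAlg k) where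
  /-- The three functionals. -/
  (X Y Z : Fin T.t → k)
  /-- Three branches at which the functionals are dual. -/
  (i₁ i₂ i₃ : Fin T.t)
  /-- The two relations. -/
  (r₁ r₂ : Fin T.t → k)
  hX : ∀ u : Fin T.t → k, ∑ i, u i • wE i ∈ T.I → ∑ i, u i * X i = 0
  hY : ∀ u : Fin T.t → k, ∑ i, u i • wE i ∈ T.I → ∑ i, u i * Y i = 0
  hZ : ∀ u : Fin T.t → k, ∑ i, u i • wE i ∈ T.I → ∑ i, u i * Z i = 0
  h₁ : X i₁ = 1 ∧ Y i₁ = 0 ∧ Z i₁ = 0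
  h₂ : X i₂ = 0 ∧ Y i₂ = 1 ∧ Z i₂ = 0
  h₃ : X i₃ = 0 ∧ Y i₃ = 0 ∧ Z i₃ = 1
  hr₁ : ∑ i, r₁ i • wE i ∈ T.I
  hr₂ : ∑ i, r₂ i • wE i ∈ T.I
  orth : ∀ i, X i * r₁ i + Y i * r₂ i = 0
  ne_zero : ∃ i, r₁ i ≠ 0 ∨ r₂ i ≠ 0

variable {k : Type u} [Field k]

lemma exists_cycle_solution (p₁ p₂ q₁ q₂ : k) : ∃ α β γ δ : k,
    p₁ * α + p₂ * β = 0 ∧ q₁ * γ + q₂ * δ = 0 ∧ p₁ * α + q₁ * γ = 0 ∧ p₂ * β + q₂ * δ = 0 ∧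
      ((α ≠ 0 ∨ β ≠ 0) ∨ γ ≠ 0 ∨ δ ≠ 0) := by
  by_cases hp₁ : p₁ = 0
  · exact ⟨1, 0, 0, 0, by simp [hp₁]⟩
  by_cases hp₂ : p₂ = 0
  · exact ⟨0, 1, 0, 0, by simp [hp₂]⟩
  by_cases hq₁ : q₁ = 0
  · exact ⟨0, 0, 1, 0, by simp [hq₁]⟩
  by_cases hq₂ : q₂ = 0
  · exact ⟨0, 0, 0, 1, by simp [hq₂]⟩
  refine ⟨p₂ * q₁ * q₂, -(p₁ * q₁ * q₂), -(p₁ * p₂ * q₂), p₁ * p₂ * q₁, ?_, ?_, ?_, ?_,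
    Or.inl (Or.inl (mul_ne_zero (mul_ne_zero hp₂ hq₁) hq₂))⟩ <;> ring

variable (T : ToupieAlg k)

lemma range_lrMap :
    LinearMap.range (lrMap T) = Submodule.span k (Set.range fun i => mkA T (wE i)) := by
  apply le_antisymm
  · rintro _ ⟨x, rfl⟩
    refine Submodule.span_mono ?_
      (QuiverRep.ev_mul_mul_ev_mem (algRep_spans T) x Vtx.src Vtx.snk)
    rintro _ ⟨p, ⟨hs, he⟩, rfl⟩
    cases p with
    | vert w =>
      obtain rfl : w = .src := hs
      cases he
    | sub i a b hab hb =>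
      obtain rfl : a = 0 := by
        by_contra ha
        exact vtx_ne_src ha hs
      obtain rfl := eq_length_of_vtx_eq_snk hb he
      exact ⟨i, (algRep_seg T _ _ _).symm⟩
  · refine Submodule.span_le.2 ?_
    rintro _ ⟨i, rfl⟩
    refine ⟨mkA T (wE i), ?_⟩
    have hl := T.hℓ i
    have h : (algRep T).seg i 0 (T.ℓ i) = mkA T (wE i) := algRep_seg T _ _ _
    change (algRep T).ev .src * mkA T (wE i) * (algRep T).ev .snk = mkA T (wE i)
    rw [← h, ← vtx_zero i, QuiverRep.ev_mul_seg _ hl, ← vtx_length hl, QuiverRep.seg_mul_ev _ hl]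

variable {T}

lemma sum_smul_wE_mem {u : Fin T.t → k} :
    ∑ i, u i • wE i ∈ T.I ↔ ∑ i, u i • mkA T (wE i) = 0 := by
  rw [← mkAlg_eq_zero, map_sum]
  simp only [map_smul, mkAlg_apply]

lemma nonempty_branchData (h3 : 3 ≤ mDim T) (ht : mDim T + 1 < T.t) :
    Nonempty (BranchData T) := by
  set v : Fin T.t → Alg T := fun i => mkA T (wE i) with hv
  obtain ⟨κ, a, ha, hspan, hli⟩ := exists_linearIndependent' k v
  have : Finite κ := Finite.of_injective a ha
  have := Fintype.ofFinite κ
  have hcard : Fintype.card κ = mDim T := by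
    rw [mDim, range_lrMap, ← hspan, finrank_span_eq_card hli]
  have hC : ∀ i, ∃ c : κ → k, ∑ j, c j • v (a j) = v i := fun i =>
    (Submodule.mem_span_range_iff_exists_fun k).1
      (show v i ∈ Submodule.span k (Set.range (v ∘ a)) from
        hspan ▸ Submodule.subset_span ⟨i, rfl⟩)
  choose C hC using hC
  have hzero : ∀ c : κ → k, ∑ j, c j • v (a j) = 0 → ∀ j, c j = 0 :=
    Fintype.linearIndependent_iff.1 hli
  have hCa : ∀ j j', C (a j) j' = if j' = j then 1 else 0 := fun j j' => by
    have := hzero (fun j' => C (a j) j' - if j' = j then 1 else 0)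
      (by simp [sub_smul, Finset.sum_sub_distrib, hC]) j'
    exact sub_eq_zero.1 this
  have hU : ∀ u : Fin T.t → k, ∑ i, u i • wE i ∈ T.I → ∀ j, ∑ i, u i * C i j = 0 := by
    intro u hu
    refine hzero _ ?_
    rw [sum_smul_wE_mem] at hu
    simp_rw [Finset.sum_smul]
    rw [Finset.sum_comm]
    simp_rw [mul_smul, ← Finset.smul_sum, hC]
    exact hu
  obtain ⟨j₁, j₂, j₃, h12, h13, h23⟩ := Fintype.two_lt_card_iff.1 (by omega : 2 < Fintype.card κ)
  have hcompl : 1 < ((Finset.univ.image a)ᶜ : Finset (Fin T.t)).card := by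
    rw [Finset.card_compl, Finset.card_image_of_injective _ ha, Fintype.card_fin,
      Finset.card_univ]
    omega
  obtain ⟨p, hp, q, hq, hpq⟩ := Finset.one_lt_card.1 hcompl
  simp only [Finset.mem_compl, Finset.mem_image, Finset.mem_univ, true_and, not_exists] at hp hq
  let U : Fin T.t → Fin T.t → k := fun s i =>
    (if i = s then 1 else 0) - ∑ j, if a j = i then C s j else 0
  have hUI : ∀ s, ∑ i, U s i • v i = 0 := fun s => by
    simp only [U, sub_smul, Finset.sum_sub_distrib, Finset.sum_smul]
    rw [Finset.sum_comm (f := fun i j => (if a j = i then C s j else 0) • v i)]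
    simp [ite_smul, hC]
  have hUs : ∀ s s', (∀ j, a j ≠ s') → U s s' = if s' = s then 1 else 0 := fun s s' hs => by
    simp [U, hs]
  have hUa : ∀ s j, (∀ j, a j ≠ s) → U s (a j) = - C s j := fun s j hs => by
    simp [U, hs, ha.eq_iff]
  obtain ⟨α, β, γ, δ, e1, e2, e3, e4, hne⟩ :=
    exists_cycle_solution (C p j₁) (C p j₂) (C q j₁) (C q j₂)
  have hcomb : ∀ α γ : k, ∑ i, (α * U p i + γ * U q i) • wE i ∈ T.I := fun α γ => by
    rw [sum_smul_wE_mem]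
    simp_rw [add_smul, Finset.sum_add_distrib, mul_smul, ← Finset.smul_sum]
    rw [hUI p, hUI q, smul_zero, smul_zero, add_zero]
  refine ⟨{
    X := fun i => C i j₁, Y := fun i => C i j₂, Z := fun i => C i j₃
    i₁ := a j₁, i₂ := a j₂, i₃ := a j₃
    r₁ := fun i => α * U p i + γ * U q i
    r₂ := fun i => β * U p i + δ * U q i
    hX := fun u hu => hU u hu _, hY := fun u hu => hU u hu _, hZ := fun u hu => hU u hu _
    h₁ := by simp [hCa, h12.symm, h13.symm]
    h₂ := by simp [hCa, h12, h23.symm]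
    h₃ := by simp [hCa, h13, h23]
    hr₁ := hcomb α γ, hr₂ := hcomb β δ
    orth := ?_, ne_zero := ?_ }⟩
  · intro i
    by_cases hi : ∃ j, a j = i
    · obtain ⟨j, rfl⟩ := hi
      simp only [hCa, hUa p j hp, hUa q j hq]
      by_cases h1 : j = j₁
      · subst h1
        simp only [if_true, if_neg h12.symm]
        linear_combination - e3
      · by_cases h2 : j = j₂
        · subst h2
          simp only [if_true, if_neg h12]
          linear_combination - e4
        · simp [Ne.symm h1, Ne.symm h2]
    · push Not at hi
      simp only [hUs p i hi, hUs q i hi]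
      by_cases h1 : i = p
      · subst h1
        simp only [if_true, if_neg hpq]
        linear_combination e1
      · by_cases h2 : i = q
        · subst h2
          simp only [if_true, if_neg h1]
          linear_combination e2
        · simp [h1, h2]
  · rcases hne with h | h
    · exact ⟨p, by simpa [hUs p p hp, hUs q p hp, hpq] using h⟩
    · exact ⟨q, by simpa [hUs p q hq, hUs q q hq, hpq.symm] using h⟩

end Toupie

namespace Toupie

lemma exists_comp_eq_of_ker_le {R : Type u} [Ring R] {C X Y : Type u} [AddCommGroup C]
    [Module R C] [AddCommGroup X] [Module R X] [AddCommGroup Y] [Module R Y]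
    (hC : Module.Injective R C) (p : X →ₗ[R] Y) (g : X →ₗ[R] C)
    (h : ∀ x, p x = 0 → g x = 0) : ∃ e : Y →ₗ[R] C, ∀ x, e (p x) = g x := by
  obtain ⟨e, he⟩ := hC.out ((LinearMap.ker p).liftQ p le_rfl)
    (LinearMap.ker_eq_bot.1 (Submodule.ker_liftQ_eq_bot _ _ _ le_rfl))
    ((LinearMap.ker p).liftQ g fun x hx => h x hx)
  exact ⟨e, fun x => he (Submodule.Quotient.mk x)⟩

variable {k : Type u} [Field k] {T : ToupieAlg k}

section Projective

variable {P : Type u} [AddCommGroup P] [Module (Alg T)ᵐᵒᵖ P]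

lemma eq_zero_of_ar_smul_eq_zero (hsc : SimplyConnected T)
    (hP : Module.Projective (Alg T)ᵐᵒᵖ P) {i : Fin T.t} {x : P}
    (hx : op ((algRep T).ev .src) • x = x) (h : op ((algRep T).ar i 0) • x = 0) : x = 0 := by
  obtain ⟨s, hs⟩ := hP.out
  have hsx : s x = 0 := by
    ext p
    have h1 := DFunLike.congr_fun (congrArg s hx) p
    have h2 := DFunLike.congr_fun (congrArg s h) p
    rw [map_smul, Finsupp.smul_apply, smul_eq_mul] at h1 h2
    rw [map_zero, Finsupp.zero_apply] at h2
    exact unop_injective (eq_zero_of_mul_ar_eq_zero hsc (congrArg unop h1) (congrArg unop h2))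
  rw [← hs x, hsx, map_zero]

lemma exists_eq_ar_smul (hsc : SimplyConnected T) (hP : Module.Projective (Alg T)ᵐᵒᵖ P)
    {κ : Fin T.t → P} (hκ : ∀ i, op ((algRep T).ev (vtx T.t T.ℓ i 1)) • κ i = κ i)
    (h : ∑ i, op ((algRep T).seg i 1 (T.ℓ i)) • κ i = 0) (i : Fin T.t) :
    ∃ x : P, κ i = op ((algRep T).ar i 0) • x := by
  obtain ⟨s, hs⟩ := hP.out
  have hd : ∀ p, ∃ d : k, (s (κ i) p).unop = d • (algRep T).ar i 0 := fun p => by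
    refine exists_eq_smul_ar_zero hsc (a := fun j => (s (κ j) p).unop) (fun j => ?_) ?_ i
    · have h1 := DFunLike.congr_fun (congrArg s (hκ j)) p
      rw [map_smul, Finsupp.smul_apply, smul_eq_mul] at h1
      exact congrArg unop h1
    · have h1 := congrArg (fun y => (s y p).unop) h
      simpa [map_sum, Finsupp.finsetSum_apply] using h1
  choose d hd using hd
  refine ⟨∑ p ∈ (s (κ i)).support, algebraMap k (Alg T)ᵐᵒᵖ (d p) • p, ?_⟩
  conv_lhs => rw [← hs (κ i)]
  rw [Finsupp.linearCombination_apply, Finsupp.sum, Finset.smul_sum]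
  refine Finset.sum_congr rfl fun p _ => ?_
  rw [smul_smul, id, ← op_unop (s (κ i) p), hd p, ← Algebra.commutes, ← Algebra.smul_def, op_smul]

end Projective

lemma not_pdLeOne (hsc : SimplyConnected T) {N : Type u} [AddCommGroup N]
    [Module (Alg T)ᵐᵒᵖ N] {r₁ r₂ : Fin T.t → k} (hr₁ : ∑ i, r₁ i • wE i ∈ T.I)
    (hr₂ : ∑ i, r₂ i • wE i ∈ T.I) {y₁ y₂ : N}
    (h : ∀ i, op ((algRep T).ar i 0) • (op (r₁ i • (algRep T).ev .src) • y₁ +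
      op (r₂ i • (algRep T).ev .src) • y₂) = 0)
    {i : Fin T.t} (hi : op (r₁ i • (algRep T).ev .src) • y₁ +
      op (r₂ i • (algRep T).ev .src) • y₂ ≠ 0) :
    ¬ PdLeOne (Alg T)ᵐᵒᵖ (ModuleCat.of (Alg T)ᵐᵒᵖ N) := by
  rintro ⟨P, f, hf, hP, hK⟩
  set D := algRep T with hD
  obtain ⟨Y₁, hY₁⟩ := hf y₁
  obtain ⟨Y₂, hY₂⟩ := hf y₂
  let x : Fin T.t → P := fun j => op (r₁ j • D.ev .src) • Y₁ + op (r₂ j • D.ev .src) • Y₂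
  have hfx : ∀ j, f (x j) = op (r₁ j • D.ev .src) • y₁ + op (r₂ j • D.ev .src) • y₂ :=
    fun j => by
      simp only [x]
      rw [map_add, map_smul, map_smul, hY₁, hY₂]
  have hxe : ∀ j, op (D.ev .src) • x j = x j := fun j => by
    simp only [x, smul_add, smul_smul, ← op_mul, smul_mul_assoc, D.ev_mul_ev, if_true]
  let κ : Fin T.t → LinearMap.ker f := fun j => ⟨op (D.ar j 0) • x j, by
    rw [LinearMap.mem_ker, map_smul, hfx]
    exact h j⟩
  have hw : ∀ r : Fin T.t → k, ∑ j, r j • wE j ∈ T.I → ∀ Y : P,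
      ∑ j, op (r j • D.seg j 0 (T.ℓ j)) • Y = 0 := fun r hr Y => by
    rw [← Finset.sum_smul, ← Finset.op_sum]
    have : ∑ j, r j • D.seg j 0 (T.ℓ j) = 0 := by
      rw [sum_smul_wE_mem] at hr
      simp only [hD, algRep_seg]
      exact hr
    rw [this, op_zero, zero_smul]
  obtain ⟨z, hz⟩ := exists_eq_ar_smul hsc hK (κ := κ)
    (fun j => by
      ext
      simp only [κ, Submodule.coe_smul, smul_smul, ← op_mul]
      rw [← zero_add 1, D.ar_mul_ev])
    (by
      ext
      have hseg : ∀ j, op (D.seg j 1 (T.ℓ j)) • op (D.ar j 0) • x j =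
          op (r₁ j • D.seg j 0 (T.ℓ j)) • Y₁ + op (r₂ j • D.seg j 0 (T.ℓ j)) • Y₂ :=
        fun j => by
          have hs : D.ev .src * D.seg j 0 (T.ℓ j) = D.seg j 0 (T.ℓ j) := by
            rw [← vtx_zero j, D.ev_mul_seg (T.hℓ j)]
          simp only [x, smul_add, smul_smul, ← op_mul, smul_mul_assoc, mul_assoc]
          rw [← D.seg_eq_ar_mul (T.hℓ j), hs]
      simp only [κ, Submodule.coe_sum, Submodule.coe_smul, Submodule.coe_zero]
      refine (Finset.sum_congr rfl fun j _ => hseg j).trans ?_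
      rw [Finset.sum_add_distrib, hw r₁ hr₁, hw r₂ hr₂, add_zero]) i
  have hz' : op (D.ar i 0) • x i = op (D.ar i 0) • (z : P) := congrArg Subtype.val hz
  have hzero : x i - op (D.ev .src) • (z : P) = 0 := by
    refine eq_zero_of_ar_smul_eq_zero (i := i) hsc hP ?_ ?_
    · rw [smul_sub, hxe, smul_smul, ← op_mul, D.ev_mul_ev, if_pos rfl]
    · rw [smul_sub, hz', smul_smul, ← op_mul]
      have : D.ev .src * D.ar i 0 = D.ar i 0 := by rw [← vtx_zero i, D.ev_mul_ar]
      rw [this, sub_self]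
  refine hi ?_
  rw [← hfx, sub_eq_zero.1 hzero, map_smul, LinearMap.mem_ker.1 z.2, smul_zero]

lemma op_algebraMap_smul_comm {E : Type u} [AddCommGroup E] [Module (Alg T)ᵐᵒᵖ E] (d : k)
    (a : Alg T) (x : E) : op (d • a) • x = algebraMap k (Alg T)ᵐᵒᵖ d • op a • x := by
  rw [smul_smul, ← Algebra.smul_def, op_smul]

lemma not_idLeOne (hsc : SimplyConnected T) {N : Type u} [AddCommGroup N]
    [Module (Alg T)ᵐᵒᵖ N] [Module k N] [IsScalarTower k (Alg T)ᵐᵒᵖ N]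
    {G : Type*} [AddCommGroup G] [Module k G] {r₁ r₂ : Fin T.t → k}
    (hr₁ : ∑ i, r₁ i • wE i ∈ T.I) (hr₂ : ∑ i, r₂ i • wE i ∈ T.I) {ξ₁ ξ₂ : N →ₗ[k] G}
    (h : ∀ i n, r₁ i • ξ₁ (op ((algRep T).ar i (T.ℓ i - 1)) • n) +
      r₂ i • ξ₂ (op ((algRep T).ar i (T.ℓ i - 1)) • n) = 0)
    {i : Fin T.t} {n : N} (hi : r₁ i • ξ₁ (op ((algRep T).ev .snk) • n) +
      r₂ i • ξ₂ (op ((algRep T).ev .snk) • n) ≠ 0) :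
    ¬ IdLeOne (Alg T)ᵐᵒᵖ (ModuleCat.of (Alg T)ᵐᵒᵖ N) := by
  rintro ⟨E, f', hf', hE, hC⟩
  set D := algRep T with hD
  let f : N →ₗ[(Alg T)ᵐᵒᵖ] E := f'
  have hf : Function.Injective f := hf'
  let _ : Module k E := Module.compHom E (algebraMap k (Alg T)ᵐᵒᵖ)
  have hkE : ∀ (c : k) (x : E), c • x = algebraMap k (Alg T)ᵐᵒᵖ c • x := fun _ _ => rfl
  have : IsScalarTower k (Alg T)ᵐᵒᵖ E :=
    ⟨fun c r x => by rw [hkE, Algebra.smul_def, mul_smul]⟩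
  obtain ⟨g, hg⟩ := (f.restrictScalars k).exists_leftInverse_of_injective
    (LinearMap.ker_eq_bot.2 hf)
  have hgf : ∀ y, g (f y) = y := fun y => LinearMap.congr_fun hg y
  let Ξ : Fin T.t → E →ₗ[k] G := fun j => (r₁ j • ξ₁ + r₂ j • ξ₂).comp g
  have hΞ : ∀ j y, Ξ j (f (op (D.ar j (T.ℓ j - 1)) • y)) = 0 := fun j y => by
    simp only [Ξ, LinearMap.comp_apply, LinearMap.add_apply, LinearMap.smul_apply, hgf]
    exact h j y
  have hl := two_le_length hsc
  have hhead : ∀ j, D.seg j 0 (T.ℓ j) = D.seg j 0 (T.ℓ j - 1) * D.ar j (T.ℓ j - 1) :=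
    fun j => by
      have := hl j
      rw [← D.seg_eq_mul_ar (by omega), Nat.sub_add_cancel (by omega)]
  -- divide the sink component of `n` by the last arrow of the branch `i`
  obtain ⟨e', he'⟩ : ∃ e' : E, op (D.ar i (T.ℓ i - 1)) • e' = op (D.ev .snk) • f n := by
    obtain ⟨φ, hφ⟩ := exists_comp_eq_of_ker_le hE
      (LinearMap.toSpanSingleton (Alg T)ᵐᵒᵖ (Alg T)ᵐᵒᵖ (op (D.ar i (T.ℓ i - 1))))
      (LinearMap.toSpanSingleton (Alg T)ᵐᵒᵖ E (op (D.ev .snk) • f n)) (fun r hr => by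
        rw [LinearMap.toSpanSingleton_apply] at hr ⊢
        have h0 := ev_snk_mul_eq_zero hsc (congrArg unop hr)
        rw [smul_smul, ← op_unop r, ← op_mul, h0, op_zero, zero_smul])
    refine ⟨φ 1, ?_⟩
    rw [← map_smul, smul_eq_mul, mul_one]
    simpa using hφ 1
  -- extend the class of `e'` along the first part of the branch `i`
  obtain ⟨e, he⟩ : ∃ e : E, ∀ j, ∃ y : N, op (D.seg j 0 (T.ℓ j - 1)) • e =
      f y + if j = i then op (D.ev (vtx T.t T.ℓ i (T.ℓ i - 1))) • e' else 0 := by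
    let π : E →ₗ[(Alg T)ᵐᵒᵖ] E ⧸ LinearMap.range f := (LinearMap.range f).mkQ
    have hπ : ∀ y, π (f y) = 0 := fun y =>
      (Submodule.Quotient.mk_eq_zero _).2 (LinearMap.mem_range_self f y)
    obtain ⟨φ, hφ⟩ := exists_comp_eq_of_ker_le (X := Fin T.t → (Alg T)ᵐᵒᵖ) hC
      (∑ j, (LinearMap.toSpanSingleton (Alg T)ᵐᵒᵖ (Alg T)ᵐᵒᵖ
        (op (D.seg j 0 (T.ℓ j - 1)))).comp (LinearMap.proj j))
      ((LinearMap.toSpanSingleton (Alg T)ᵐᵒᵖ _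
        (op (D.ev (vtx T.t T.ℓ i (T.ℓ i - 1))) • π e')).comp (LinearMap.proj i))
      (fun r hr => by
        simp only [LinearMap.sum_apply, LinearMap.comp_apply, LinearMap.proj_apply,
          LinearMap.toSpanSingleton_apply, smul_eq_mul] at hr ⊢
        have hr' : ∑ j, D.seg j 0 (T.ℓ j - 1) * (r j).unop = 0 := by
          simpa using congrArg unop hr
        obtain ⟨d, hd⟩ := exists_ev_mul_eq_smul_ar hsc hr' i
        rw [smul_smul, ← op_unop (r i), ← op_mul, hd, op_algebraMap_smul_comm, ← map_smul, he',
          map_smul, hπ, smul_zero, smul_zero])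
    obtain ⟨e, he⟩ := Submodule.mkQ_surjective _ (φ 1)
    refine ⟨e, fun j => ?_⟩
    have h1 : π (op (D.seg j 0 (T.ℓ j - 1)) • e) =
        π (if j = i then op (D.ev (vtx T.t T.ℓ i (T.ℓ i - 1))) • e' else 0) := by
      have h2 := hφ (Pi.single j 1)
      simp only [LinearMap.sum_apply, LinearMap.comp_apply, LinearMap.proj_apply,
          LinearMap.toSpanSingleton_apply, smul_eq_mul] at h2
      rw [Finset.sum_eq_single j (fun j' _ hj => by rw [Pi.single_eq_of_ne hj, zero_mul])
        (by simp), Pi.single_eq_same, one_mul, ← mul_one (op (D.seg j 0 (T.ℓ j - 1))),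
        ← smul_eq_mul, map_smul] at h2
      rw [map_smul]
      refine (congrArg _ he).trans (h2.trans ?_)
      by_cases hj : j = i
      · subst hj
        rw [Pi.single_eq_same, one_smul, if_pos rfl, map_smul]
      · rw [Pi.single_eq_of_ne (Ne.symm hj), zero_smul, if_neg hj, map_zero]
    obtain ⟨y, hy⟩ := (Submodule.Quotient.eq _).1 h1
    exact ⟨y, by rw [hy, sub_add_cancel]⟩
  have hsum : ∑ j, Ξ j (op (D.seg j 0 (T.ℓ j)) • e) = 0 := by
    have hw : ∀ r : Fin T.t → k, ∑ j, r j • wE j ∈ T.I →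
        ∑ j, r j • op (D.seg j 0 (T.ℓ j)) • e = 0 := fun r hr => by
      simp_rw [hkE, ← op_algebraMap_smul_comm]
      rw [← Finset.sum_smul, ← Finset.op_sum]
      have : ∑ j, r j • D.seg j 0 (T.ℓ j) = 0 := by
        rw [sum_smul_wE_mem] at hr
        simp only [hD, algRep_seg]
        exact hr
      rw [this, op_zero, zero_smul]
    simp only [Ξ, LinearMap.comp_apply, LinearMap.add_apply, LinearMap.smul_apply,
      Finset.sum_add_distrib, ← map_smul]
    rw [← map_sum, ← map_sum, ← map_sum, ← map_sum, hw r₁ hr₁, hw r₂ hr₂]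
    simp
  rw [Finset.sum_eq_single i (fun j _ hj => by
    obtain ⟨y, hy⟩ := he j
    rw [hhead, op_mul, mul_smul, hy, if_neg hj, add_zero, ← map_smul, hΞ]) (by simp)] at hsum
  obtain ⟨y, hy⟩ := he i
  rw [hhead, op_mul, mul_smul, hy, if_pos rfl, smul_add, ← map_smul, map_add, hΞ, zero_add,
    smul_smul, ← op_mul, D.ev_mul_ar, he', ← map_smul] at hsum
  refine hi ?_
  simpa only [Ξ, LinearMap.comp_apply, LinearMap.add_apply, LinearMap.smul_apply, hgf] using hsum

end Toupie

namespace Toupie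

variable {k : Type u} [Field k] {T : ToupieAlg k} {E : Type u} [AddCommGroup E] [Module k E]

/-- A representation of a simply connected toupie algebra with the same space `E` at all
vertices, all of whose arrows but the first one on each branch are identities. -/
structure BranchRep (T : ToupieAlg k) (E : Type u) [AddCommGroup E] [Module k E] where
  /-- The map along the branch `i`. -/
  φ : Fin T.t → Module.End k E
  rel : ∀ u : Fin T.t → k, ∑ i, u i • wE i ∈ T.I → ∑ i, u i • φ i = 0
  sc : SimplyConnected T

namespace BranchRep

variable (ρ : BranchRep T E)

/-- The operators given by the vertices and the arrows. -/
def quiverRep : QuiverRep k T.t T.ℓ (Module.End k (Vtx T.t T.ℓ → E))ᵐᵒᵖ where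
  ev v := op (LinearMap.single k (fun _ => E) v ∘ₗ LinearMap.proj v)
  ar i j := if j < T.ℓ i then op (LinearMap.single k (fun _ => E) (vtx T.t T.ℓ i (j + 1)) ∘ₗ
    (if j = 0 then ρ.φ i else LinearMap.id) ∘ₗ LinearMap.proj (vtx T.t T.ℓ i j)) else 0
  ev_mul_ev v w := by
    rw [← op_mul]
    split_ifs with h
    · subst h
      congr 1
      ext; simp
    · rw [op_eq_zero_iff]
      refine LinearMap.ext fun f => ?_
      simp [Pi.single_eq_of_ne (Ne.symm h)]
  sum_ev := by
    rw [← Finset.op_sum, op_eq_one_iff]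
    refine LinearMap.ext fun f => ?_
    simp [LinearMap.sum_apply, Finset.univ_sum_single]
  ev_mul_ar i j := by
    by_cases h : j < T.ℓ i
    · rw [if_pos h, ← op_mul]
      congr 1
      refine LinearMap.ext fun f => ?_
      simp
    · rw [if_neg h, mul_zero]
  ar_mul_ev i j := by
    by_cases h : j < T.ℓ i
    · rw [if_pos h, ← op_mul]
      congr 1
      refine LinearMap.ext fun f => ?_
      simp
    · rw [if_neg h, zero_mul]
  ar_eq_zero i j h := if_neg (by omega)

lemma quiverRep_ar_zero (i : Fin T.t) : ρ.quiverRep.ar i 0 =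
    op (LinearMap.single k (fun _ => E) (vtx T.t T.ℓ i 1) ∘ₗ ρ.φ i ∘ₗ
      LinearMap.proj Vtx.src) := by
  simp [quiverRep, (show 0 < T.ℓ i from T.hℓ i).ne']

lemma quiverRep_ar {i : Fin T.t} {j : ℕ} (h0 : j ≠ 0) (hj : j < T.ℓ i) : ρ.quiverRep.ar i j =
    op (LinearMap.single k (fun _ => E) (vtx T.t T.ℓ i (j + 1)) ∘ₗ
      LinearMap.proj (vtx T.t T.ℓ i j)) := by
  simp [quiverRep, h0, hj]

lemma quiverRep_seg {i : Fin T.t} {j : ℕ} (hj : j < T.ℓ i) : ρ.quiverRep.seg i 0 (j + 1) =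
    op (LinearMap.single k (fun _ => E) (vtx T.t T.ℓ i (j + 1)) ∘ₗ ρ.φ i ∘ₗ
      LinearMap.proj Vtx.src) := by
  induction j with
  | zero => rw [QuiverRep.seg_succ, quiverRep_ar_zero]
  | succ j ih =>
    rw [QuiverRep.seg_eq_mul_ar _ (Nat.zero_le _), ih (by omega), quiverRep_ar _ (by omega) hj,
      ← op_mul]
    congr 1
    refine LinearMap.ext fun f => ?_
    simp

lemma quiverRep_seg_length (i : Fin T.t) : ρ.quiverRep.seg i 0 (T.ℓ i) =
    op (LinearMap.single k (fun _ => E) Vtx.snk ∘ₗ ρ.φ i ∘ₗ LinearMap.proj Vtx.src) := by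
  have hl := T.hℓ i
  have h := ρ.quiverRep_seg (i := i) (j := T.ℓ i - 1) (by omega)
  rwa [Nat.sub_add_cancel hl, vtx_length hl] at h

lemma lift_eq_zero {x : PathAlg k T.t T.ℓ} (hx : x ∈ T.I) : ρ.quiverRep.lift x = 0 := by
  obtain ⟨u, rfl⟩ := (Submodule.mem_span_range_iff_exists_fun k).1 (mem_span_wE ρ.sc hx)
  rw [map_sum]
  simp only [map_smul, wE, QuiverRep.lift_subE, quiverRep_seg_length, ← op_smul]
  rw [← Finset.op_sum, op_eq_zero_iff]
  refine LinearMap.ext fun f => ?_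
  have h := LinearMap.congr_fun (ρ.rel u hx) (f .src)
  simp only [LinearMap.sum_apply, LinearMap.smul_apply, LinearMap.zero_apply,
    LinearMap.comp_apply, LinearMap.proj_apply, ← map_smul] at h ⊢
  rw [← map_sum, h, map_zero]

/-- The action of the toupie algebra on a representation. -/
def toEnd : Alg T →ₐ[k] (Module.End k (Vtx T.t T.ℓ → E))ᵐᵒᵖ :=
  { T.I.ringCon.lift ρ.quiverRep.lift.toRingHom (fun x y h => by
      have h0 := ρ.lift_eq_zero ((TwoSidedIdeal.rel_iff _ _ _).1 h)
      rw [map_sub, sub_eq_zero] at h0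
      exact h0) with
    commutes' := fun c => ρ.quiverRep.lift.commutes c }

lemma toEnd_mkA (x : PathAlg k T.t T.ℓ) : ρ.toEnd (mkA T x) = ρ.quiverRep.lift x := rfl

lemma toEnd_ev (v : Vtx T.t T.ℓ) : ρ.toEnd ((algRep T).ev v) = ρ.quiverRep.ev v :=
  ρ.quiverRep.lift_eV v

lemma toEnd_ar (i : Fin T.t) (j : ℕ) : ρ.toEnd ((algRep T).ar i j) = ρ.quiverRep.ar i j :=
  ρ.quiverRep.lift_arE i j

lemma toEnd_seg (i : Fin T.t) (a b : ℕ) :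
    ρ.toEnd ((algRep T).seg i a b) = ρ.quiverRep.seg i a b := by
  rw [algRep_seg, toEnd_mkA, QuiverRep.lift_subE]

/-- The space underlying a representation. -/
@[nolint unusedArguments]
def Carrier (_ : BranchRep T E) : Type u := Vtx T.t T.ℓ → E

instance : AddCommGroup ρ.Carrier := inferInstanceAs (AddCommGroup (Vtx T.t T.ℓ → E))

instance : Module k ρ.Carrier := inferInstanceAs (Module k (Vtx T.t T.ℓ → E))

instance [FiniteDimensional k E] : FiniteDimensional k ρ.Carrier :=
  inferInstanceAs (FiniteDimensional k (Vtx T.t T.ℓ → E))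

instance : Module (Alg T)ᵐᵒᵖ ρ.Carrier where
  smul a f := (ρ.toEnd a.unop).unop f
  one_smul f := by
    change (ρ.toEnd 1).unop f = f
    rw [map_one]
    rfl
  mul_smul a b f := by
    change (ρ.toEnd (b.unop * a.unop)).unop f = _
    rw [map_mul]
    rfl
  smul_zero a := map_zero (ρ.toEnd a.unop).unop
  smul_add a := map_add (ρ.toEnd a.unop).unop
  add_smul a b f := by
    change (ρ.toEnd (a.unop + b.unop)).unop f = _
    rw [map_add]
    rfl
  zero_smul f := by
    change (ρ.toEnd 0).unop f = 0
    rw [map_zero]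
    rfl

lemma op_smul_def (a : Alg T) (f : ρ.Carrier) : op a • f = (ρ.toEnd a).unop f := rfl

instance : IsScalarTower k (Alg T)ᵐᵒᵖ ρ.Carrier where
  smul_assoc c a f := by
    change (ρ.toEnd (c • a.unop)).unop f = c • (ρ.toEnd a.unop).unop f
    rw [map_smul]
    rfl

lemma ev_smul (v : Vtx T.t T.ℓ) (f : ρ.Carrier) :
    op ((algRep T).ev v) • f = Pi.single v (f v) := by
  rw [op_smul_def, toEnd_ev]
  rfl

lemma ar_zero_smul (i : Fin T.t) (f : ρ.Carrier) :
    op ((algRep T).ar i 0) • f = Pi.single (vtx T.t T.ℓ i 1) (ρ.φ i (f .src)) := by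
  rw [op_smul_def, toEnd_ar, quiverRep_ar_zero]
  rfl

lemma ar_smul {i : Fin T.t} {j : ℕ} (h0 : j ≠ 0) (hj : j < T.ℓ i) (f : ρ.Carrier) :
    op ((algRep T).ar i j) • f = Pi.single (vtx T.t T.ℓ i (j + 1)) (f (vtx T.t T.ℓ i j)) := by
  rw [op_smul_def, toEnd_ar, quiverRep_ar _ h0 hj]
  rfl

lemma seg_smul {i : Fin T.t} {j : ℕ} (hj : j < T.ℓ i) (f : ρ.Carrier) :
    op ((algRep T).seg i 0 (j + 1)) • f =
      Pi.single (vtx T.t T.ℓ i (j + 1)) (ρ.φ i (f .src)) := by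
  rw [op_smul_def, toEnd_seg, quiverRep_seg _ hj]
  rfl

lemma seg_length_smul (i : Fin T.t) (f : ρ.Carrier) :
    op ((algRep T).seg i 0 (T.ℓ i)) • f = Pi.single Vtx.snk (ρ.φ i (f .src)) := by
  rw [op_smul_def, toEnd_seg, quiverRep_seg_length]
  rfl

/-- The elements whose component at an inner vertex of the branch `i` lies in the range of the
map along this branch. -/
def rangeSub : Submodule k ρ.Carrier where
  carrier := {f | ∀ i a, f (.mid i a) ∈ LinearMap.range (ρ.φ i)}
  add_mem' hf hg i a := add_mem (hf i a) (hg i a)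
  zero_mem' _ _ := zero_mem _
  smul_mem' c _ hf i a := Submodule.smul_mem _ c (hf i a)

lemma single_src_mem (e : E) : (Pi.single Vtx.src e : Vtx T.t T.ℓ → E) ∈ ρ.rangeSub :=
  fun i a => by simp

lemma single_snk_mem (e : E) : (Pi.single Vtx.snk e : Vtx T.t T.ℓ → E) ∈ ρ.rangeSub :=
  fun i a => by simp

lemma single_mid_mem (i : Fin T.t) (a : Fin (T.ℓ i - 1)) {e : E}
    (he : e ∈ LinearMap.range (ρ.φ i)) :
    (Pi.single (Vtx.mid i a) e : Vtx T.t T.ℓ → E) ∈ ρ.rangeSub := fun i' a' => by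
  by_cases h : Vtx.mid i' a' = Vtx.mid i a
  · obtain ⟨rfl, h⟩ := Vtx.mid.inj h
    obtain rfl := eq_of_heq h
    rwa [Pi.single_eq_same]
  · rw [Pi.single_eq_of_ne h]
    exact zero_mem _

lemma single_vtx_mem (i : Fin T.t) (j : ℕ) {e : E} (he : e ∈ LinearMap.range (ρ.φ i)) :
    (Pi.single (vtx T.t T.ℓ i j) e : Vtx T.t T.ℓ → E) ∈ ρ.rangeSub := by
  unfold vtx
  split_ifs
  · exact ρ.single_src_mem e
  · exact ρ.single_mid_mem i _ he
  · exact ρ.single_snk_mem e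

lemma apply_vtx_mem {f : ρ.Carrier} (hf : f ∈ ρ.rangeSub) {i : Fin T.t} {j : ℕ} (h0 : j ≠ 0)
    (hj : j < T.ℓ i) : f (vtx T.t T.ℓ i j) ∈ LinearMap.range (ρ.φ i) := by
  rw [vtx_mid h0 (by omega)]
  exact hf i _

lemma ar_smul_mem (i : Fin T.t) (j : ℕ) {f : ρ.Carrier} (hf : f ∈ ρ.rangeSub) :
    op ((algRep T).ar i j) • f ∈ ρ.rangeSub := by
  by_cases hj : j < T.ℓ i
  · by_cases h0 : j = 0
    · subst h0
      rw [ar_zero_smul]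
      exact ρ.single_vtx_mem i _ ⟨_, rfl⟩
    · rw [ρ.ar_smul h0 hj]
      exact ρ.single_vtx_mem i _ (ρ.apply_vtx_mem hf h0 hj)
  · rw [(algRep T).ar_eq_zero i j (by omega), op_zero, zero_smul]
    exact zero_mem _

lemma ev_smul_mem (v : Vtx T.t T.ℓ) {f : ρ.Carrier} (hf : f ∈ ρ.rangeSub) :
    op ((algRep T).ev v) • f ∈ ρ.rangeSub := by
  rw [ev_smul]
  cases v with
  | src => exact ρ.single_src_mem _
  | snk => exact ρ.single_snk_mem _
  | mid i a => exact ρ.single_mid_mem i a (hf i a)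

lemma seg_smul_mem (i : Fin T.t) {a b : ℕ} (hab : a ≤ b) {f : ρ.Carrier}
    (hf : f ∈ ρ.rangeSub) : op ((algRep T).seg i a b) • f ∈ ρ.rangeSub := by
  induction b, hab using Nat.le_induction with
  | base => rwa [QuiverRep.seg_self, op_one, one_smul]
  | succ b hab ih =>
    rw [QuiverRep.seg_eq_mul_ar _ hab, op_mul, mul_smul]
    exact ρ.ar_smul_mem i b ih

lemma smul_mem_rangeSub (a : (Alg T)ᵐᵒᵖ) {f : ρ.Carrier} (hf : f ∈ ρ.rangeSub) :
    a • f ∈ ρ.rangeSub := by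
  obtain ⟨c, hc⟩ := algRep_spans T a.unop
  rw [← op_unop a, hc, Finset.op_sum, Finset.sum_smul]
  refine Submodule.sum_mem _ fun p _ => ?_
  rw [op_smul, smul_assoc]
  refine Submodule.smul_mem _ _ ?_
  cases p with
  | vert v => exact ρ.ev_smul_mem v hf
  | sub i a b hab hb => exact ρ.seg_smul_mem i hab.le hf

/-- The submodule of a representation generated by the source and the sink. -/
def gen : Submodule (Alg T)ᵐᵒᵖ ρ.Carrier where
  __ := ρ.rangeSub
  smul_mem' a _ hf := ρ.smul_mem_rangeSub a hf

instance [FiniteDimensional k E] : FiniteDimensional k ρ.gen :=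
  Module.Finite.of_injective (ρ.gen.subtype.restrictScalars k) Subtype.val_injective

lemma fdMod [FiniteDimensional k E] :
    FdMod (Alg T)ᵐᵒᵖ (ModuleCat.of (Alg T)ᵐᵒᵖ ρ.gen) :=
  Module.Finite.of_restrictScalars_finite k (Alg T)ᵐᵒᵖ ρ.gen

/-- Elements supported at the source. -/
def ofSrc : E →ₗ[k] ρ.gen where
  toFun e := ⟨Pi.single Vtx.src e, ρ.single_src_mem e⟩
  map_add' e e' := Subtype.ext (map_add (LinearMap.single k (fun _ => E) Vtx.src) e e')
  map_smul' c e := Subtype.ext (map_smul (LinearMap.single k (fun _ => E) Vtx.src) c e)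

/-- Elements supported at the sink. -/
def ofSnk : E →ₗ[k] ρ.gen where
  toFun e := ⟨Pi.single Vtx.snk e, ρ.single_snk_mem e⟩
  map_add' e e' := Subtype.ext (map_add (LinearMap.single k (fun _ => E) Vtx.snk) e e')
  map_smul' c e := Subtype.ext (map_smul (LinearMap.single k (fun _ => E) Vtx.snk) c e)

/-- The component at a vertex. -/
def proj (v : Vtx T.t T.ℓ) : ρ.gen →ₗ[k] E where
  toFun m := m.1 v
  map_add' _ _ := rfl
  map_smul' _ _ := rfl

end BranchRep

end Toupie

namespace Toupie

namespace BranchRep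

variable {k : Type u} [Field k] {T : ToupieAlg k}
  {E E' : Type u} [AddCommGroup E] [Module k E] [AddCommGroup E'] [Module k E']
  (ρ : BranchRep T E) (ρ' : BranchRep T E')

@[simp] lemma proj_src_ofSrc (e : E) : ρ.proj .src (ρ.ofSrc e) = e := by
  change (Pi.single Vtx.src e : Vtx T.t T.ℓ → E) Vtx.src = e
  exact Pi.single_eq_same _ _

@[simp] lemma proj_snk_ofSnk (e : E) : ρ.proj .snk (ρ.ofSnk e) = e := by
  change (Pi.single Vtx.snk e : Vtx T.t T.ℓ → E) Vtx.snk = e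
  exact Pi.single_eq_same _ _

lemma ev_src_smul (m : ρ.gen) : op ((algRep T).ev .src) • m = ρ.ofSrc (ρ.proj .src m) :=
  Subtype.ext (ρ.ev_smul .src m.1)

lemma ev_snk_smul (m : ρ.gen) : op ((algRep T).ev .snk) • m = ρ.ofSnk (ρ.proj .snk m) :=
  Subtype.ext (ρ.ev_smul .snk m.1)

lemma ev_mid_smul (i : Fin T.t) (a : Fin (T.ℓ i - 1)) (m : ρ.gen) :
    ∃ e, op ((algRep T).ev (.mid i a)) • m =
      op ((algRep T).seg i 0 (a + 1)) • ρ.ofSrc e := by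
  obtain ⟨e, he⟩ := m.2 i a
  refine ⟨e, Subtype.ext ?_⟩
  have ha : (a : ℕ) < T.ℓ i - 1 := a.2
  have h1 := ρ.ev_smul (.mid i a) m.1
  have h2 := ρ.seg_smul (i := i) (j := a) (by omega) (ρ.ofSrc e).1
  have h3 : (ρ.ofSrc e).1 .src = e := proj_src_ofSrc ρ e
  rw [vtx_mid (Nat.succ_ne_zero _) (by simp), h3, he] at h2
  exact h1.trans h2.symm

lemma seg_smul_ofSrc (i : Fin T.t) (e : E) :
    op ((algRep T).seg i 0 (T.ℓ i)) • ρ.ofSrc e = ρ.ofSnk (ρ.φ i e) := by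
  refine Subtype.ext ((ρ.seg_length_smul i (ρ.ofSrc e).1).trans ?_)
  rw [show (ρ.ofSrc e).1 .src = e from proj_src_ofSrc ρ e]
  rfl

variable {ρ ρ'}

lemma hom_ext {F G : ρ.gen →ₗ[(Alg T)ᵐᵒᵖ] ρ'.gen} (hsrc : ∀ e, F (ρ.ofSrc e) = G (ρ.ofSrc e))
    (hsnk : ∀ e, F (ρ.ofSnk e) = G (ρ.ofSnk e)) : F = G := by
  refine LinearMap.ext fun m => ?_
  have hm : m = ∑ v, op ((algRep T).ev v) • m := by
    rw [← Finset.sum_smul, ← Finset.op_sum, (algRep T).sum_ev, op_one, one_smul]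
  rw [hm, map_sum, map_sum]
  refine Finset.sum_congr rfl fun v _ => ?_
  cases v with
  | src => rw [ev_src_smul, hsrc]
  | snk => rw [ev_snk_smul, hsnk]
  | mid i a =>
    obtain ⟨e, he⟩ := ρ.ev_mid_smul i a m
    rw [he, map_smul, map_smul, hsrc]

/-- The component of a homomorphism at the source. -/
def srcMap (F : ρ.gen →ₗ[(Alg T)ᵐᵒᵖ] ρ'.gen) : E →ₗ[k] E' :=
  ρ'.proj .src ∘ₗ F.restrictScalars k ∘ₗ ρ.ofSrc

/-- The component of a homomorphism at the sink. -/
def snkMap (F : ρ.gen →ₗ[(Alg T)ᵐᵒᵖ] ρ'.gen) : E →ₗ[k] E' :=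
  ρ'.proj .snk ∘ₗ F.restrictScalars k ∘ₗ ρ.ofSnk

variable (F : ρ.gen →ₗ[(Alg T)ᵐᵒᵖ] ρ'.gen)

lemma hom_ofSrc (e : E) : F (ρ.ofSrc e) = ρ'.ofSrc (srcMap F e) := by
  change _ = ρ'.ofSrc (ρ'.proj .src (F (ρ.ofSrc e)))
  rw [← ev_src_smul, ← map_smul, ev_src_smul, proj_src_ofSrc]

lemma hom_ofSnk (e : E) : F (ρ.ofSnk e) = ρ'.ofSnk (snkMap F e) := by
  change _ = ρ'.ofSnk (ρ'.proj .snk (F (ρ.ofSnk e)))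
  rw [← ev_snk_smul, ← map_smul, ev_snk_smul, proj_snk_ofSnk]

lemma snkMap_φ (i : Fin T.t) (e : E) : snkMap F (ρ.φ i e) = ρ'.φ i (srcMap F e) := by
  have h := congrArg (ρ'.proj .snk) (F.map_smul (op ((algRep T).seg i 0 (T.ℓ i))) (ρ.ofSrc e))
  rwa [seg_smul_ofSrc, hom_ofSrc, hom_ofSnk, seg_smul_ofSrc, proj_snk_ofSnk,
    proj_snk_ofSnk] at h

lemma srcMap_injective (hF : Function.Injective F) : Function.Injective (srcMap F) := by
  intro e e' h
  have h1 : F (ρ.ofSrc e) = F (ρ.ofSrc e') := by rw [hom_ofSrc, hom_ofSrc, h]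
  have h2 := congrArg (ρ.proj .src) (hF h1)
  simpa using h2

/-- A representation is indecomposable as soon as the commuting pairs of idempotents are
trivial. -/
lemma indec [Nontrivial E]
    (h : ∀ f g : Module.End k E, f ∘ₗ f = f → g ∘ₗ g = g → (∀ i e, g (ρ.φ i e) = ρ.φ i (f e)) →
      (f = 0 ∧ g = 0) ∨ (f = LinearMap.id ∧ g = LinearMap.id)) :
    Indec (Alg T)ᵐᵒᵖ (ModuleCat.of (Alg T)ᵐᵒᵖ ρ.gen) := by
  constructor
  · obtain ⟨e, e', hne⟩ := exists_pair_ne E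
    exact ⟨ρ.ofSrc e, ρ.ofSrc e', fun h => hne (by simpa using congrArg (ρ.proj .src) h)⟩
  · intro F hF
    have hF' : ∀ m : ρ.gen, F (F m) = F m := fun m => LinearMap.congr_fun hF m
    have hf : srcMap (ρ := ρ) (ρ' := ρ) F ∘ₗ srcMap F = srcMap F := by
      refine LinearMap.ext fun e => ?_
      have h1 := congrArg (ρ.proj .src) (hF' (ρ.ofSrc e))
      rwa [hom_ofSrc, hom_ofSrc, proj_src_ofSrc, proj_src_ofSrc] at h1
    have hg : snkMap (ρ := ρ) (ρ' := ρ) F ∘ₗ snkMap F = snkMap F := by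
      refine LinearMap.ext fun e => ?_
      have h1 := congrArg (ρ.proj .snk) (hF' (ρ.ofSnk e))
      rwa [hom_ofSnk, hom_ofSnk, proj_snk_ofSnk, proj_snk_ofSnk] at h1
    rcases h _ _ hf hg (snkMap_φ F) with ⟨h1, h2⟩ | ⟨h1, h2⟩
    · refine Or.inl (hom_ext (ρ := ρ) (ρ' := ρ) (fun e => ?_) fun e => ?_)
      · rw [hom_ofSrc, h1, LinearMap.zero_apply, map_zero]
        rfl
      · rw [hom_ofSnk, h2, LinearMap.zero_apply, map_zero]
        rfl
    · refine Or.inr (hom_ext (ρ := ρ) (ρ' := ρ) (fun e => ?_) fun e => ?_)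
      · rw [hom_ofSrc, h1]
        rfl
      · rw [hom_ofSnk, h2]
        rfl

end BranchRep

/-! ### A pencil of maps -/

section Pencil

variable {k : Type u} [Field k] {W : Type u} [AddCommGroup W] [Module k W] (s : Module.End k W)

/-- The first map of the pencil. -/
def pencilX : Module.End k (W × W × W × W) where
  toFun p := (p.1, p.2.2.1, p.2.2.2, 0)
  map_add' _ _ := by simp
  map_smul' _ _ := by simp

/-- The second map of the pencil. -/
def pencilY : Module.End k (W × W × W × W) where
  toFun p := (p.2.1, s p.2.2.1, 0, p.2.2.2)
  map_add' _ _ := by simp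
  map_smul' _ _ := by simp

/-- The third map of the pencil. -/
def pencilZ : Module.End k (W × W × W × W) where
  toFun p := (p.2.2.1, p.2.2.2, 0, 0)
  map_add' _ _ := by simp
  map_smul' _ _ := by simp

@[simp] lemma pencilX_apply (a b c d : W) : pencilX (k := k) (a, b, c, d) = (a, c, d, 0) := rfl
@[simp] lemma pencilY_apply (a b c d : W) : pencilY s (a, b, c, d) = (b, s c, 0, d) := rfl
@[simp] lemma pencilZ_apply (a b c d : W) : pencilZ (k := k) (a, b, c, d) = (c, d, 0, 0) := rfl

variable {s} {f g : Module.End k (W × W × W × W)}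

/-- The diagonal entry of an endomorphism of the pencil. -/
def pencilDiag (f : Module.End k (W × W × W × W)) : Module.End k W :=
  LinearMap.fst k W (W × W) ∘ₗ LinearMap.snd k W (W × W × W) ∘ₗ f ∘ₗ
    LinearMap.inr k W (W × W × W) ∘ₗ LinearMap.inl k W (W × W)

lemma pencilDiag_apply (f : Module.End k (W × W × W × W)) (w : W) :
    pencilDiag f w = (f (0, w, 0, 0)).2.1 := rfl

lemma pencil_shape (hX : ∀ p, g (pencilX (k := k) p) = pencilX (k := k) (f p))
    (hY : ∀ p, g (pencilY s p) = pencilY s (f p)) (hZ : ∀ p, g (pencilZ (k := k) p) = pencilZ (k := k) (f p))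
    (w : W) :
    f (w, 0, 0, 0) = (pencilDiag f w, 0, 0, 0) ∧ f (0, w, 0, 0) = (0, pencilDiag f w, 0, 0) ∧
      (∃ a b, f (0, 0, w, 0) = (a, b, pencilDiag f w, 0)) ∧
      g (w, 0, 0, 0) = (pencilDiag f w, 0, 0, 0) ∧ pencilDiag f (s w) = s (pencilDiag f w) := by
  have hg0 : g (0, 0, 0, 0) = (0, 0, 0, 0) := map_zero g
  have e2 : ∀ w, f (0, w, 0, 0) = (0, pencilDiag f w, 0, 0) := fun w => by
    have h := hX (0, w, 0, 0)
    rw [pencilDiag_apply]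
    obtain ⟨⟨a, b, c, d⟩, hp⟩ : ∃ p, f (0, w, 0, 0) = p := ⟨_, rfl⟩
    rw [pencilX_apply, hg0, hp, pencilX_apply, Prod.mk.injEq, Prod.mk.injEq, Prod.mk.injEq] at h
    rw [hp, ← h.1, ← h.2.1, ← h.2.2.1]
  have g1 : ∀ w, g (w, 0, 0, 0) = (pencilDiag f w, 0, 0, 0) := fun w => by
    have h := hY (0, w, 0, 0)
    rwa [e2, pencilY_apply, pencilY_apply, map_zero] at h
  have e1 : ∀ w, f (w, 0, 0, 0) = (pencilDiag f w, 0, 0, 0) := fun w => by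
    have h1 := hX (w, 0, 0, 0)
    have h2 := hY (w, 0, 0, 0)
    obtain ⟨⟨a, b, c, d⟩, hp⟩ : ∃ p, f (w, 0, 0, 0) = p := ⟨_, rfl⟩
    rw [pencilX_apply, g1, hp, pencilX_apply, Prod.mk.injEq, Prod.mk.injEq, Prod.mk.injEq] at h1
    rw [pencilY_apply, map_zero, hg0, hp, pencilY_apply, Prod.mk.injEq] at h2
    rw [hp, h1.1, ← h2.1, ← h1.2.1, ← h1.2.2.1]
  have e3 : ∀ w, ∃ a b, f (0, 0, w, 0) = (a, b, pencilDiag f w, 0) := fun w => by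
    have h := hZ (0, 0, w, 0)
    rw [pencilZ_apply, g1] at h
    generalize f (0, 0, w, 0) = p at h ⊢
    obtain ⟨a, b, c, d⟩ := p
    simp only [pencilZ_apply, Prod.ext_iff] at h
    exact ⟨a, b, by rw [h.1, h.2.1]⟩
  refine ⟨e1 w, e2 w, e3 w, g1 w, ?_⟩
  obtain ⟨a, b, hab⟩ := e3 w
  obtain ⟨a', b', hab'⟩ := e3 (s w)
  have h1 := hY (0, 0, w, 0)
  have h2 := hX (0, 0, s w, 0)
  rw [hab, pencilY_apply, pencilY_apply] at h1
  rw [hab', pencilX_apply, pencilX_apply, h1] at h2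
  exact (congrArg (fun p => p.2.1) h2).symm

lemma pencil_eq_zero (hf : f ∘ₗ f = f) (hX : ∀ p, g (pencilX (k := k) p) = pencilX (k := k) (f p))
    (hY : ∀ p, g (pencilY s p) = pencilY s (f p)) (hZ : ∀ p, g (pencilZ (k := k) p) = pencilZ (k := k) (f p))
    (h0 : pencilDiag f = 0) : f = 0 ∧ g = 0 := by
  have hff : ∀ p, f (f p) = f p := fun p => LinearMap.congr_fun hf p
  have hs := pencil_shape hX hY hZ
  simp only [h0, LinearMap.zero_apply] at hs
  have split : ∀ a b c d : W, (a, b, c, d) =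
      (a, 0, 0, 0) + (0, b, 0, 0) + (0, 0, c, 0) + (0, 0, 0, d) := fun a b c d => by simp
  have h12 : ∀ a b, f (a, b, 0, 0) = 0 := fun a b => by
    rw [show (a, b, (0 : W), (0 : W)) = (a, 0, 0, 0) + (0, b, 0, 0) by simp, map_add, (hs a).1,
      (hs b).2.1]
    simp
  have h3 : ∀ w, f (0, 0, w, 0) = 0 := fun w => by
    obtain ⟨a, b, hab⟩ := (hs w).2.2.1
    rw [← hff, hab, h12]
  have g2 : ∀ w, g (0, w, 0, 0) = 0 := fun w => by
    simpa [h3] using hX (0, 0, w, 0)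
  have h4 : ∀ w, f (0, 0, 0, w) = 0 := fun w => by
    have h := hZ (0, 0, 0, w)
    rw [pencilZ_apply, g2] at h
    obtain ⟨⟨a, b, c, d⟩, hp⟩ : ∃ p, f (0, 0, 0, w) = p := ⟨_, rfl⟩
    rw [hp, pencilZ_apply] at h
    simp only [Prod.ext_iff, Prod.fst_zero, Prod.snd_zero] at h
    rw [← h.1, ← h.2.1] at hp
    rw [← hff, hp, h12]
  have hf0 : ∀ p, f p = 0 := by
    rintro ⟨a, b, c, d⟩
    rw [split, map_add, map_add, map_add, h3, h4, (hs a).1, (hs b).2.1]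
    simp
  have g3 : ∀ w, g (0, 0, w, 0) = 0 := fun w => by
    simpa [hf0] using hX (0, 0, 0, w)
  have g4 : ∀ w, g (0, 0, 0, w) = 0 := fun w => by
    simpa [hf0] using hY (0, 0, 0, w)
  refine ⟨LinearMap.ext hf0, LinearMap.ext ?_⟩
  rintro ⟨a, b, c, d⟩
  rw [split, map_add, map_add, map_add, g2, g3, g4, (hs a).2.2.2.1]
  simp

lemma pencil_trivial (hs : ∀ A : Module.End k W, A ∘ₗ A = A → (∀ w, A (s w) = s (A w)) →
      A = 0 ∨ A = LinearMap.id)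
    (hf : f ∘ₗ f = f) (hX : ∀ p, g (pencilX (k := k) p) = pencilX (k := k) (f p))
    (hY : ∀ p, g (pencilY s p) = pencilY s (f p)) (hZ : ∀ p, g (pencilZ (k := k) p) = pencilZ (k := k) (f p)) :
    (f = 0 ∧ g = 0) ∨ (f = LinearMap.id ∧ g = LinearMap.id) := by
  have hsh := pencil_shape hX hY hZ
  have hff : ∀ p, f (f p) = f p := fun p => LinearMap.congr_fun hf p
  have hA : pencilDiag f ∘ₗ pencilDiag f = pencilDiag f := LinearMap.ext fun w => by
    have h := hff (w, 0, 0, 0)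
    rw [(hsh w).1, (hsh _).1] at h
    exact congrArg (fun p => p.1) h
  rcases hs _ hA (fun w => (hsh w).2.2.2.2) with h0 | h1
  · exact Or.inl (pencil_eq_zero hf hX hY hZ h0)
  · refine Or.inr ?_
    obtain ⟨h2, h3⟩ := pencil_eq_zero (s := s) (f := LinearMap.id - f) (g := LinearMap.id - g)
      (LinearMap.ext fun p => by simp [hff]) (fun p => by simp [hX]) (fun p => by simp [hY])
      (fun p => by simp [hZ]) (LinearMap.ext fun w => by
        rw [pencilDiag_apply, LinearMap.sub_apply, (hsh w).2.1, h1]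
        simp)
    exact ⟨(sub_eq_zero.1 h2).symm, (sub_eq_zero.1 h3).symm⟩

end Pencil

/-! ### The nilpotent Jordan block -/

section Jordan

open Polynomial

variable (k : Type u) [Field k] (n : ℕ)

/-- The space of truncated polynomials. -/
abbrev Trunc : Type u := AdjoinRoot (X ^ (n + 1) : k[X])

/-- Multiplication by the variable. -/
def truncMul : Module.End k (Trunc k n) := LinearMap.mulLeft k (AdjoinRoot.root _)

lemma finrank_trunc : Module.finrank k (Trunc k n) = n + 1 := by
  rw [(AdjoinRoot.powerBasis (pow_ne_zero (n + 1) (X_ne_zero (R := k)))).finrank,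
    AdjoinRoot.powerBasis_dim, natDegree_X_pow]

instance : FiniteDimensional k (Trunc k n) :=
  (AdjoinRoot.powerBasis (pow_ne_zero (n + 1) (X_ne_zero (R := k)))).finite

instance : Nontrivial (Trunc k n) :=
  Module.nontrivial_of_finrank_pos (R := k) (by rw [finrank_trunc]; omega)

variable {k n}

lemma trunc_idempotent {A : Module.End k (Trunc k n)} (hA : A ∘ₗ A = A)
    (h : ∀ w, A (truncMul k n w) = truncMul k n (A w)) : A = 0 ∨ A = LinearMap.id := by
  have hmul : ∀ (p : k[X]) (w : Trunc k n),
      A (AdjoinRoot.mk _ p * w) = AdjoinRoot.mk _ p * A w := by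
    intro p
    induction p using Polynomial.induction_on with
    | C a =>
      intro w
      rw [AdjoinRoot.mk_C, ← AdjoinRoot.algebraMap_eq, ← Algebra.smul_def, ← Algebra.smul_def,
        map_smul]
    | add p q hp hq => intro w; rw [map_add, add_mul, map_add, hp, hq, add_mul]
    | monomial m a ih =>
      intro w
      have hr : AdjoinRoot.mk (X ^ (n + 1) : k[X]) (C a * X ^ (m + 1)) =
          AdjoinRoot.mk _ (C a * X ^ m) * AdjoinRoot.root _ := by
        rw [pow_succ X m, ← mul_assoc, map_mul, AdjoinRoot.mk_X]
      rw [hr, mul_assoc, mul_assoc, ih]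
      exact congrArg _ (h w)
  obtain ⟨p, hp⟩ := AdjoinRoot.mk_surjective (A 1)
  have hA1 : ∀ w, A w = w * AdjoinRoot.mk _ p := fun w => by
    obtain ⟨q, rfl⟩ := AdjoinRoot.mk_surjective w
    rw [hp, ← hmul, mul_one]
  have hdvd : (X ^ (n + 1) : k[X]) ∣ p * (p - 1) := by
    rw [← AdjoinRoot.mk_eq_zero, map_mul, map_sub, map_one, mul_sub, mul_one, sub_eq_zero,
      ← hA1, hp]
    exact LinearMap.congr_fun hA 1
  by_cases hX : (X : k[X]) ∣ p
  · left
    have hX' : ¬ (X : k[X]) ∣ p - 1 := fun h' => by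
      have := (dvd_sub_right hX).1 h'
      exact not_isUnit_X (isUnit_of_dvd_one this)
    have hcop : IsCoprime (X ^ (n + 1) : k[X]) (p - 1) :=
      (((irreducible_X).coprime_iff_not_dvd).2 hX').pow_left
    refine LinearMap.ext fun w => ?_
    rw [hA1, AdjoinRoot.mk_eq_zero.2 (hcop.dvd_of_dvd_mul_right hdvd), mul_zero]
    rfl
  · right
    have hcop : IsCoprime (X ^ (n + 1) : k[X]) p :=
      (((irreducible_X).coprime_iff_not_dvd).2 hX).pow_left
    have h1 := AdjoinRoot.mk_eq_zero.2 (hcop.dvd_of_dvd_mul_left hdvd)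
    rw [map_sub, map_one, sub_eq_zero] at h1
    refine LinearMap.ext fun w => ?_
    rw [hA1, h1, mul_one]
    rfl

end Jordan

end Toupie

namespace Toupie

variable {k : Type u} [Field k] {T : ToupieAlg k}

/-! ### A family of indecomposable modules -/

namespace BranchData

variable (hsc : SimplyConnected T) (δ : BranchData T) (n : ℕ)

/-- The representations given by the pencil and the nilpotent Jordan blocks. -/
def pencilRep : BranchRep T (Trunc k n × Trunc k n × Trunc k n × Trunc k n) where
  φ i := δ.X i • pencilX + δ.Y i • pencilY (truncMul k n) + δ.Z i • pencilZ
  rel u hu := by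
    simp only [smul_add, smul_smul, Finset.sum_add_distrib, ← Finset.sum_smul]
    rw [δ.hX u hu, δ.hY u hu, δ.hZ u hu]
    simp
  sc := hsc

lemma pencilRep_φ_apply (i : Fin T.t) (a b c d : Trunc k n) :
    (δ.pencilRep hsc n).φ i (a, b, c, d) =
      (δ.X i • a + δ.Y i • b + δ.Z i • c, δ.X i • c + δ.Y i • truncMul k n c + δ.Z i • d,
        δ.X i • d, δ.Y i • d) := by
  simp [pencilRep]

/-- The family of modules. -/
abbrev pencilMod : ModuleCat.{u} (Alg T)ᵐᵒᵖ :=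
  ModuleCat.of (Alg T)ᵐᵒᵖ (δ.pencilRep hsc n).gen

lemma indec_pencilMod : Indec (Alg T)ᵐᵒᵖ (δ.pencilMod hsc n) := by
  refine BranchRep.indec fun f g hf _ h => ?_
  have hX : ∀ p, g (pencilX (k := k) p) = pencilX (k := k) (f p) := fun p => by
    simpa [pencilRep, δ.h₁] using h δ.i₁ p
  have hY : ∀ p, g (pencilY (truncMul k n) p) = pencilY (truncMul k n) (f p) := fun p => by
    simpa [pencilRep, δ.h₂] using h δ.i₂ p
  have hZ : ∀ p, g (pencilZ (k := k) p) = pencilZ (k := k) (f p) := fun p => by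
    simpa [pencilRep, δ.h₃] using h δ.i₃ p
  exact pencil_trivial (fun A hA hs => trunc_idempotent hA hs) hf hX hY hZ

lemma not_pdLeOne_pencilMod : ¬ PdLeOne (Alg T)ᵐᵒᵖ (δ.pencilMod hsc n) := by
  set ρ := δ.pencilRep hsc n
  have hsum : ∀ i, op (δ.r₁ i • (algRep T).ev .src) • ρ.ofSrc (1, 0, 0, 0) +
      op (δ.r₂ i • (algRep T).ev .src) • ρ.ofSrc (0, 1, 0, 0) =
        ρ.ofSrc (δ.r₁ i • 1, δ.r₂ i • 1, 0, 0) := fun i => by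
    rw [op_smul, op_smul, smul_assoc, smul_assoc, BranchRep.ev_src_smul, BranchRep.ev_src_smul,
      BranchRep.proj_src_ofSrc, BranchRep.proj_src_ofSrc, ← map_smul, ← map_smul, ← map_add]
    simp
  obtain ⟨i, hi⟩ := δ.ne_zero
  refine not_pdLeOne hsc δ.hr₁ δ.hr₂ (y₁ := ρ.ofSrc (1, 0, 0, 0)) (y₂ := ρ.ofSrc (0, 1, 0, 0))
    (fun j => ?_) (i := i) ?_
  · rw [hsum]
    refine Subtype.ext ((ρ.ar_zero_smul j _).trans ?_)
    have h0 : ρ.φ j (ρ.proj .src (ρ.ofSrc (δ.r₁ j • 1, δ.r₂ j • 1, 0, 0))) = 0 := by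
      rw [BranchRep.proj_src_ofSrc, pencilRep_φ_apply, smul_smul, smul_smul, ← add_smul, δ.orth]
      simp
    exact (congrArg (LinearMap.single k (fun _ : Vtx T.t T.ℓ => _) (vtx T.t T.ℓ j 1)) h0).trans
      (map_zero _)
  · rw [hsum]
    intro h
    have h1 := congrArg (ρ.proj .src) h
    rw [BranchRep.proj_src_ofSrc, map_zero] at h1
    simp only [Prod.ext_iff] at h1
    have h2 : δ.r₁ i = 0 := (smul_eq_zero.1 h1.1).resolve_right one_ne_zero
    have h3 : δ.r₂ i = 0 := (smul_eq_zero.1 h1.2.1).resolve_right one_ne_zero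
    exact hi.elim (· h2) (· h3)

lemma not_idLeOne_pencilMod : ¬ IdLeOne (Alg T)ᵐᵒᵖ (δ.pencilMod hsc n) := by
  set ρ := δ.pencilRep hsc n
  let W := Trunc k n
  let ξ₁ : ρ.gen →ₗ[k] W := LinearMap.fst k W W ∘ₗ LinearMap.snd k W (W × W) ∘ₗ
    LinearMap.snd k W (W × W × W) ∘ₗ ρ.proj .snk
  let ξ₂ : ρ.gen →ₗ[k] W := LinearMap.snd k W W ∘ₗ LinearMap.snd k W (W × W) ∘ₗ
    LinearMap.snd k W (W × W × W) ∘ₗ ρ.proj .snk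
  have hsnk : ∀ a b c d : W, ξ₁ (op ((algRep T).ev .snk) • ρ.ofSnk (a, b, c, d)) = c ∧
      ξ₂ (op ((algRep T).ev .snk) • ρ.ofSnk (a, b, c, d)) = d := fun a b c d => by
    rw [BranchRep.ev_snk_smul, BranchRep.proj_snk_ofSnk]
    have h := BranchRep.proj_snk_ofSnk ρ (a, b, c, d)
    exact ⟨congrArg (fun p => p.2.2.1) h, congrArg (fun p => p.2.2.2) h⟩
  have har : ∀ i (m : ρ.gen), δ.r₁ i • ξ₁ (op ((algRep T).ar i (T.ℓ i - 1)) • m) +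
      δ.r₂ i • ξ₂ (op ((algRep T).ar i (T.ℓ i - 1)) • m) = 0 := fun i m => by
    have hl := two_le_length hsc i
    obtain ⟨⟨a, b, c, d⟩, hp⟩ :=
      ρ.apply_vtx_mem m.2 (i := i) (j := T.ℓ i - 1) (by omega) (by omega)
    have h : ρ.proj .snk (op ((algRep T).ar i (T.ℓ i - 1)) • m) = ρ.φ i (a, b, c, d) := by
      refine (congrFun (ρ.ar_smul (i := i) (j := T.ℓ i - 1) (by omega) (by omega) m.1)
        Vtx.snk).trans ?_
      rw [Nat.sub_add_cancel (by omega), vtx_length (by omega), Pi.single_eq_same, hp]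
    rw [pencilRep_φ_apply] at h
    have h1 : ξ₁ (op ((algRep T).ar i (T.ℓ i - 1)) • m) = δ.X i • d :=
      congrArg (fun p => p.2.2.1) h
    have h2 : ξ₂ (op ((algRep T).ar i (T.ℓ i - 1)) • m) = δ.Y i • d :=
      congrArg (fun p => p.2.2.2) h
    rw [h1, h2, smul_smul, smul_smul, ← add_smul, mul_comm, mul_comm (δ.r₂ i), δ.orth, zero_smul]
  obtain ⟨i, hi | hi⟩ := δ.ne_zero
  · refine not_idLeOne hsc δ.hr₁ δ.hr₂ har (i := i) (n := ρ.ofSnk (0, 0, 1, 0)) ?_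
    rw [(hsnk _ _ _ _).1, (hsnk _ _ _ _).2, smul_zero, add_zero]
    exact smul_ne_zero hi one_ne_zero
  · refine not_idLeOne hsc δ.hr₁ δ.hr₂ har (i := i) (n := ρ.ofSnk (0, 0, 0, 1)) ?_
    rw [(hsnk _ _ _ _).1, (hsnk _ _ _ _).2, smul_zero, zero_add]
    exact smul_ne_zero hi one_ne_zero

variable {n} in
lemma le_of_pencilMod_equiv {n' : ℕ}
    (F : δ.pencilMod hsc n ≃ₗ[(Alg T)ᵐᵒᵖ] δ.pencilMod hsc n') : n ≤ n' := by
  have h := LinearMap.finrank_le_finrank_of_injective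
    (BranchRep.srcMap_injective (ρ := δ.pencilRep hsc n) (ρ' := δ.pencilRep hsc n')
      F.toLinearMap F.injective)
  simp only [Module.finrank_prod, finrank_trunc] at h
  omega

end BranchData

end Toupie

namespace Toupie

/-- A simply connected toupie algebra with `m = dim_k e₀ A e∞ ≥ 3`
and `t > m + 1` branches is not a laura algebra. -/
theorem not_laura_of_m_add_one_lt_t {k : Type u} [Field k] (T : ToupieAlg k)
    (hsc : SimplyConnected T) (hm : 3 ≤ mDim T) (ht : mDim T + 1 < T.t) :
    ¬ Laura (Alg T)ᵐᵒᵖ := by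
  rintro ⟨S, hS, hlaura⟩
  obtain ⟨δ⟩ := nonempty_branchData hm ht
  have hfd : ∀ n, FdMod (Alg T)ᵐᵒᵖ (δ.pencilMod hsc n) := fun n => BranchRep.fdMod _
  have h : ∀ n, ∃ N : S, Nonempty (δ.pencilMod hsc n ≃ₗ[(Alg T)ᵐᵒᵖ] N.1) := fun n => by
    obtain ⟨N, hN, e⟩ := hlaura _ (δ.indec_pencilMod hsc n) (hfd n)
      (fun hL => δ.not_pdLeOne_pencilMod hsc n
        (hL.2.2 _ (δ.indec_pencilMod hsc n) (hfd n) Relation.ReflTransGen.refl))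
      (fun hR => δ.not_idLeOne_pencilMod hsc n
        (hR.2.2 _ (δ.indec_pencilMod hsc n) (hfd n) Relation.ReflTransGen.refl))
    exact ⟨⟨N, hN⟩, e⟩
  choose N e using h
  have : Finite S := hS
  obtain ⟨n, n', hne, hN⟩ := Finite.exists_ne_map_eq_of_infinite N
  obtain ⟨e₁⟩ := e n
  obtain ⟨e₂⟩ := e n'
  rw [← hN] at e₂
  exact hne (le_antisymm (δ.le_of_pencilMod_equiv hsc (e₁.trans e₂.symm))
    (δ.le_of_pencilMod_equiv hsc (e₂.trans e₁.symm)))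

end Toupie
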